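/- arXiv:2512.11725 — 7 statements merged into one kernel-verified Lean document; each statement's English description precedes it below -/
import Mathlib

section
/- Let G be a connected graph of diameter at most 2 and k ≥ 1 an integer. Then G is strongly conflict-free vertex-connection k-colorable if and only if G has a proper k-coloring. Consequently, the strong conflict-free vertex-connection number of G equals its chromatic number. -/
/-- A walk in a vertex-colored graph is conflict-free if some color appears on
exactly one vertex of the walk. -/
def ConflictFree {V α : Type*} {G : SimpleGraph V} (f : V → α) {u v : V}
    (p : G.Walk u v) : Prop :=
  ∃ c : α, ∃! x, x ∈ p.support ∧ f x = c

/-- A coloring `f` is a strong conflict-free vertex-connection coloring if every two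
distinct vertices are joined by a conflict-free shortest path. -/
def IsStrongCfvc {V α : Type*} (G : SimpleGraph V) (f : V → α) : Prop :=
  ∀ u v : V, u ≠ v →
    ∃ p : G.Walk u v, p.IsPath ∧ p.length = G.dist u v ∧ ConflictFree f p

/-- `G` is strongly conflict-free vertex-connection `k`-colorable. -/
def StronglyCfvcColorable {V : Type*} (G : SimpleGraph V) (k : ℕ) : Prop :=
  ∃ f : V → Fin k, IsStrongCfvc G f

/-- Every strong conflict-free vertex-connection coloring is proper. -/
theorem IsStrongCfvc.ne_of_adj {V α : Type*} {G : SimpleGraph V} {f : V → α}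
    (hf : IsStrongCfvc G f) {u v : V} (h : G.Adj u v) : f u ≠ f v := by
  intro huv
  obtain ⟨p, -, hlen, c, x, ⟨hx, hxc⟩, huniq⟩ := hf u v h.ne
  rw [SimpleGraph.dist_eq_one_iff_adj.mpr h] at hlen
  have hmem : ∀ y ∈ p.support, y = u ∨ y = v := by
    cases p with
    | nil => simp at hlen
    | cons _ q =>
      cases q with
      | nil => simp
      | cons _ _ => simp at hlen
  have hc : f u = c ∧ f v = c := by
    rcases hmem x hx with rfl | rfl
    · exact ⟨hxc, huv ▸ hxc⟩
    · exact ⟨huv.trans hxc, hxc⟩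
  exact h.ne ((huniq u ⟨p.start_mem_support, hc.1⟩).trans
    (huniq v ⟨p.end_mem_support, hc.2⟩).symm)

/-- In a connected graph of diameter at most two, every proper coloring is a strong
conflict-free vertex-connection coloring. -/
theorem SimpleGraph.Connected.isStrongCfvc_of_dist_le_two {V α : Type*} {G : SimpleGraph V}
    (hG : G.Connected) (hdiam : ∀ u v : V, G.dist u v ≤ 2) {f : V → α}
    (hf : ∀ ⦃u v : V⦄, G.Adj u v → f u ≠ f v) : IsStrongCfvc G f := by
  intro u v huv
  obtain ⟨p, hp, hlen⟩ := hG.exists_path_of_dist u v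
  refine ⟨p, hp, hlen, ?_⟩
  have hle : p.length ≤ 2 := hlen ▸ hdiam u v
  cases p with
  | nil => exact absurd rfl huv
  | @cons _ w _ h q =>
    cases q with
    | nil => exact ⟨f u, u, by simp, by simp [(hf h).symm]⟩
    | cons h' r =>
      cases r with
      | nil => exact ⟨f w, w, by simp, by simp [hf h, (hf h').symm]⟩
      | cons _ _ => simp at hle

theorem stronglyCfvcColorable_iff_colorable {V : Type*} {G : SimpleGraph V}
    (hG : G.Connected) (hdiam : ∀ u v : V, G.dist u v ≤ 2) (k : ℕ) :
    StronglyCfvcColorable G k ↔ G.Colorable k :=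
  ⟨fun ⟨f, hf⟩ => ⟨SimpleGraph.Coloring.mk f fun h => hf.ne_of_adj h⟩,
    fun ⟨C⟩ => ⟨C, hG.isStrongCfvc_of_dist_le_two hdiam fun _ _ h => C.valid h⟩⟩

/-- for a connected graph of diameter at most 2 and `k ≥ 1`,
strong cfvc `k`-colorability coincides with proper `k`-colorability; consequently the
strong conflict-free vertex-connection number equals the chromatic number. -/
theorem strongCfvc_iff_colorable_of_diam_le_two {V : Type*} [Fintype V]
    (G : SimpleGraph V) (hG : G.Connected) (hdiam : ∀ u v : V, G.dist u v ≤ 2)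
    (k : ℕ) (hk : 1 ≤ k) :
    (StronglyCfvcColorable G k ↔ G.Colorable k) ∧
    (↑(sInf {n : ℕ | StronglyCfvcColorable G n}) = G.chromaticNumber) := by
  refine ⟨stronglyCfvcColorable_iff_colorable hG hdiam k, ?_⟩
  simp only [stronglyCfvcColorable_iff_colorable hG hdiam]
  exact G.colorable_of_fintype.chromaticNumber_eq_sInf.symm
end

section
/- Let u and v be false twins in a connected graph G, and let f be a strong conflict-free vertex-connection k-coloring of G with f(u) = f(v). Then the restriction of f to V(G) \ {u} is a strong conflict-free vertex-connection k-coloring of the graph G − u. -/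
/-- The retraction of a graph onto the complement of a vertex `u`, sending `u` to a false
twin `v` of `u` and fixing every other vertex. -/
noncomputable def falseTwinRetract {V : Type*} (G : SimpleGraph V) (u v : V) (huv : u ≠ v)
    (htwin : G.neighborSet u = G.neighborSet v) : G →g G.induce ({u}ᶜ : Set V) := by
  classical
  exact
  { toFun := fun x => if h : x = u then ⟨v, huv.symm⟩ else ⟨x, h⟩
    map_rel' := by
      have htwin' : ∀ w, G.Adj u w ↔ G.Adj v w := fun w => Set.ext_iff.1 htwin w
      intro a b hab
      by_cases ha : a = u
      · subst ha
        have hb : b ≠ a := hab.ne'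
        simpa [hb] using (htwin' b).1 hab
      · by_cases hb : b = u
        · subst hb
          simpa [ha] using ((htwin' a).1 hab.symm).symm
        · simpa [ha, hb] using hab }

theorem falseTwinRetract_apply_coe {V : Type*} (G : SimpleGraph V) (u v : V) (huv : u ≠ v)
    (htwin : G.neighborSet u = G.neighborSet v) (x : ({u}ᶜ : Set V)) :
    falseTwinRetract G u v huv htwin x = x :=
  dif_neg x.2

theorem color_falseTwinRetract {V α : Type*} (G : SimpleGraph V) (u v : V) (huv : u ≠ v)
    (htwin : G.neighborSet u = G.neighborSet v) (f : V → α) (hfu : f u = f v) (x : V) :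
    f (falseTwinRetract G u v huv htwin x) = f x := by
  by_cases h : x = u
  · subst h
    simp [falseTwinRetract, hfu]
  · simp [falseTwinRetract, h]

/-- A color-preserving homomorphism maps conflict-free walks to conflict-free walks. -/
theorem ConflictFree.map {V W α : Type*} {G : SimpleGraph V} {H : SimpleGraph W}
    {f : V → α} {g : W → α} (φ : G →g H) (hφ : ∀ x, g (φ x) = f x) {a b : V}
    {p : G.Walk a b} (hp : ConflictFree f p) : ConflictFree g (p.map φ) := by
  obtain ⟨c, x, ⟨hx, hxc⟩, huniq⟩ := hp
  refine ⟨c, φ x, ⟨?_, (hφ x).trans hxc⟩, ?_⟩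
  · rw [SimpleGraph.Walk.support_map]
    exact List.mem_map_of_mem hx
  · rintro z ⟨hz, hzc⟩
    rw [SimpleGraph.Walk.support_map, List.mem_map] at hz
    obtain ⟨w, hw, rfl⟩ := hz
    rw [huniq w ⟨hw, (hφ w).symm.trans hzc⟩]

/-- Homomorphisms do not increase distances between reachable vertices. -/
theorem SimpleGraph.Reachable.dist_map_le {V W : Type*} {G : SimpleGraph V}
    {H : SimpleGraph W} (φ : G →g H) {a b : V} (h : G.Reachable a b) :
    H.dist (φ a) (φ b) ≤ G.dist a b := by
  obtain ⟨q, hq⟩ := h.exists_walk_length_eq_dist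
  rw [← hq, ← q.length_map φ]
  exact SimpleGraph.dist_le _

/-- if `u, v` are false twins in a connected graph `G` and `f` is a strong
cfvc `k`-coloring of `G` with `f u = f v`, then the restriction of `f` to `V(G) \ {u}`
is a strong cfvc `k`-coloring of `G - u`. -/
theorem strongCfvc_restrict_of_falseTwins {V : Type*} (G : SimpleGraph V)
    (hG : G.Connected) (u v : V) (huv : u ≠ v)
    (htwin : G.neighborSet u = G.neighborSet v) (k : ℕ)
    (f : V → Fin k) (hf : IsStrongCfvc G f) (hfu : f u = f v) :
    IsStrongCfvc (G.induce {u}ᶜ) (fun x : ({u}ᶜ : Set V) => f x) := by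
  intro x y hxy
  obtain ⟨p, -, hlen, hcf⟩ := hf x y (Subtype.coe_injective.ne hxy)
  set φ := falseTwinRetract G u v huv htwin
  have hx : φ x = x := falseTwinRetract_apply_coe G u v huv htwin x
  have hy : φ y = y := falseTwinRetract_apply_coe G u v huv htwin y
  have hcf' : ConflictFree (fun x : ({u}ᶜ : Set V) => f x) (p.map φ) :=
    hcf.map φ (color_falseTwinRetract G u v huv htwin f hfu)
  have hlen' : (p.map φ).length = G.dist x y := (p.length_map φ).trans hlen
  generalize p.map φ = q at hcf' hlen'
  revert q
  rw [hx, hy]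
  intro q hcf' hlen'
  have hdist : q.length = (G.induce {u}ᶜ).dist x y :=
    le_antisymm
      (hlen'.trans_le (q.reachable.dist_map_le (SimpleGraph.Embedding.induce _).toHom))
      (SimpleGraph.dist_le q)
  exact ⟨q, q.isPath_of_length_eq_dist hdist, hdist, hcf'⟩
end

section
/- Let G be a connected graph, k ≥ 1 an integer, u a vertex of G, and J ⊆ V(G) \ {u} a set of at least k + 1 vertices such that every w ∈ J satisfies N(w) = N(u) (i.e., every vertex of J is a false twin of u). Then G is strongly conflict-free vertex-connection k-colorable if and only if G − u is strongly conflict-free vertex-connection k-colorable. -/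
namespace SimpleGraph

variable {V W α : Type*} {G : SimpleGraph V} {H : SimpleGraph W}

theorem Connected.dist_map_le (hG : G.Connected) (φ : G →g H) (x y : V) :
    H.dist (φ x) (φ y) ≤ G.dist x y := by
  obtain ⟨p, hp⟩ := hG.exists_walk_length_eq_dist x y
  simpa [← hp] using dist_le (p.map φ)

/-- A section of a graph retraction preserves distances. -/
theorem Connected.dist_section (hG : G.Connected) (r : G →g H) (s : H →g G)
    (hrs : ∀ a, r (s a) = a) (a b : W) : G.dist (s a) (s b) = H.dist a b := by
  have hH : H.Connected := hG.map r fun a => ⟨s a, hrs a⟩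
  refine le_antisymm (hH.dist_map_le s a b) ?_
  simpa [hrs] using hG.dist_map_le r (s a) (s b)

/-- `x` and `y` are joined by a conflict-free shortest path. -/
def ConflictFreeGeodesic (G : SimpleGraph V) (f : V → α) (x y : V) : Prop :=
  ∃ p : G.Walk x y, p.IsPath ∧ p.length = G.dist x y ∧ ConflictFree f p

theorem ConflictFreeGeodesic.symm {f : V → α} {x y : V}
    (h : G.ConflictFreeGeodesic f x y) : G.ConflictFreeGeodesic f y x := by
  obtain ⟨p, hp, hlen, hc⟩ := h
  refine ⟨p.reverse, hp.reverse, ?_, ?_⟩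
  · rw [Walk.length_reverse, hlen, dist_comm]
  · simpa [ConflictFree] using hc

/-- A colour-preserving homomorphism that preserves the distance between `x` and `y`
carries conflict-free shortest paths between them to conflict-free shortest paths. -/
theorem ConflictFreeGeodesic.map {f : V → α} {g : W → α} {x y : V}
    (h : G.ConflictFreeGeodesic f x y) (φ : G →g H) (hφ : ∀ v, g (φ v) = f v)
    (hdist : H.dist (φ x) (φ y) = G.dist x y) :
    H.ConflictFreeGeodesic g (φ x) (φ y) := by
  obtain ⟨p, -, hlen, c, v, ⟨hv, hvc⟩, huniq⟩ := h
  have hlen' : (p.map φ).length = H.dist (φ x) (φ y) := by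
    rw [Walk.length_map, hlen, hdist]
  refine ⟨p.map φ, Walk.isPath_of_length_eq_dist _ hlen', hlen', c, φ v, ⟨?_, ?_⟩, ?_⟩
  · rw [Walk.support_map]
    exact List.mem_map_of_mem hv
  · rw [hφ, hvc]
  · rintro z ⟨hz, hzc⟩
    rw [Walk.support_map, List.mem_map] at hz
    obtain ⟨t, ht, rfl⟩ := hz
    rw [huniq t ⟨ht, (hφ t).symm.trans hzc⟩]

theorem adj_of_neighborSet_eq {a b c d : V} (hab : G.neighborSet a = G.neighborSet b)
    (hcd : G.neighborSet c = G.neighborSet d) (h : G.Adj b d) : G.Adj a c := by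
  have hda : G.Adj a d := by rwa [← mem_neighborSet, hab]
  have hca : G.Adj c a := by rw [← mem_neighborSet, hcd]; exact hda.symm
  exact hca.symm

/-- The homomorphism between an induced subgraph and `G` replacing every vertex by a vertex
with the same neighborhood. -/
def inducedTwinHom {t : Set V} (h : t → V)
    (hh : ∀ v, G.neighborSet (h v) = G.neighborSet v) : G.induce t →g G where
  toFun := h
  map_rel' hab := adj_of_neighborSet_eq (hh _) (hh _) hab

/-- The homomorphism from `G` to an induced subgraph replacing every vertex by a vertex
with the same neighborhood. -/
def twinHomInduce {t : Set V} (h : V → t)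
    (hh : ∀ v, G.neighborSet (h v) = G.neighborSet v) : G →g G.induce t where
  toFun := h
  map_rel' {a b} hab := induce_adj.2 (adj_of_neighborSet_eq (hh a) (hh b) hab)

/-- If the coloring of `G` factors through a retraction onto `H`, it restricts to a strong
conflict-free vertex-connection coloring of `H`. -/
theorem Connected.isStrongCfvc_of_retract (hG : G.Connected) (r : G →g H) (s : H →g G)
    (hrs : ∀ a, r (s a) = a) {f : V → α} {g : W → α} (hgf : ∀ v, g (r v) = f v)
    (hf : IsStrongCfvc G f) : IsStrongCfvc H g := by
  intro a b hab
  have hne : s a ≠ s b := fun h => hab (by rw [← hrs a, h, hrs])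
  have key := ConflictFreeGeodesic.map (hf _ _ hne) r hgf
    (by rw [hrs, hrs, hG.dist_section r s hrs])
  rwa [hrs, hrs] at key

section Twins

variable {u w w₁ w₂ : V}

open Classical in
/-- Replace `u` by its false twin `w`. -/
noncomputable def collapseTwin (hw : w ≠ u) (hN : G.neighborSet w = G.neighborSet u) :
    G →g G.induce {u}ᶜ :=
  twinHomInduce (fun v => if hv : v = u then ⟨w, hw⟩ else ⟨v, hv⟩) fun v => by
    by_cases hv : v = u
    · subst hv; simpa using hN
    · simp [hv]

theorem collapseTwin_self (hw : w ≠ u) (hN : G.neighborSet w = G.neighborSet u) :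
    collapseTwin hw hN u = ⟨w, hw⟩ :=
  dif_pos rfl

theorem collapseTwin_coe (hw : w ≠ u) (hN : G.neighborSet w = G.neighborSet u)
    (a : ({u}ᶜ : Set V)) : collapseTwin hw hN a = a :=
  dif_neg a.2

open Classical in
/-- Embed `G - u` in `G` by replacing `w` with its false twin `u`. -/
noncomputable def substTwin (hN : G.neighborSet w = G.neighborSet u) :
    G.induce {u}ᶜ →g G :=
  inducedTwinHom (fun v => if (v : V) = w then u else v) fun v => by
    by_cases hv : (v : V) = w
    · simp [hv, hN]
    · simp [hv]

theorem substTwin_self (hw : w ≠ u) (hN : G.neighborSet w = G.neighborSet u) :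
    substTwin hN ⟨w, hw⟩ = u :=
  if_pos rfl

theorem substTwin_of_ne (hN : G.neighborSet w = G.neighborSet u) {a : ({u}ᶜ : Set V)}
    (ha : (a : V) ≠ w) : substTwin hN a = a :=
  if_neg ha

theorem collapseTwin_substTwin (hw : w ≠ u) (hN : G.neighborSet w = G.neighborSet u)
    (a : ({u}ᶜ : Set V)) : collapseTwin hw hN (substTwin hN a) = a := by
  by_cases ha : (a : V) = w
  · obtain rfl : a = ⟨w, hw⟩ := Subtype.ext ha
    rw [substTwin_self, collapseTwin_self]
  · rw [substTwin_of_ne hN ha, collapseTwin_coe]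

open Classical in
/-- Replace `u` by its false twin `w₁` and `w₁` by its false twin `w₂`. -/
noncomputable def shiftTwins (h₁ : w₁ ≠ u) (h₂ : w₂ ≠ u)
    (hN₁ : G.neighborSet w₁ = G.neighborSet u) (hN₂ : G.neighborSet w₂ = G.neighborSet u) :
    G →g G.induce {u}ᶜ :=
  twinHomInduce
    (fun v => if hv : v = u then ⟨w₁, h₁⟩ else if v = w₁ then ⟨w₂, h₂⟩ else ⟨v, hv⟩) fun v => by
      by_cases hv : v = u
      · simp [hv, hN₁]
      · by_cases hv₁ : v = w₁
        · simp [hv₁, h₁, hN₁, hN₂]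
        · simp [hv, hv₁]

/-- If two false twins of `u` have the same color, a strong conflict-free vertex-connection
coloring of `G` yields one of `G - u`. -/
theorem Connected.isStrongCfvc_comp_substTwin (hG : G.Connected) (h₁ : w₁ ≠ u) (h₂ : w₂ ≠ u)
    (hN₁ : G.neighborSet w₁ = G.neighborSet u) (hN₂ : G.neighborSet w₂ = G.neighborSet u)
    (hne : w₁ ≠ w₂) {f : V → α} (hfw : f w₁ = f w₂) (hf : IsStrongCfvc G f) :
    IsStrongCfvc (G.induce {u}ᶜ) (f ∘ substTwin hN₁) := by
  refine hG.isStrongCfvc_of_retract (shiftTwins h₁ h₂ hN₁ hN₂) (substTwin hN₁) ?_ ?_ hf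
  · intro a
    have ha : (a : V) ≠ u := a.2
    by_cases ha₁ : (a : V) = w₁
    · obtain rfl : a = ⟨w₁, h₁⟩ := Subtype.ext ha₁
      rw [substTwin_self]
      exact dif_pos rfl
    · rw [substTwin_of_ne hN₁ ha₁]
      exact (dif_neg ha).trans (if_neg ha₁)
  · intro v
    by_cases hv : v = u
    · subst hv
      have : shiftTwins h₁ h₂ hN₁ hN₂ v = ⟨w₁, h₁⟩ := dif_pos rfl
      rw [this, Function.comp_apply, substTwin_self]
    · by_cases hv₁ : v = w₁
      · subst hv₁
        have : shiftTwins h₁ h₂ hN₁ hN₂ v = ⟨w₂, h₂⟩ := (dif_neg hv).trans (if_pos rfl)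
        rw [this, Function.comp_apply, substTwin_of_ne hN₁ hne.symm, hfw]
      · have : shiftTwins h₁ h₂ hN₁ hN₂ v = ⟨v, hv⟩ := (dif_neg hv).trans (if_neg hv₁)
        rw [this, Function.comp_apply, substTwin_of_ne hN₁ hv₁]

/-- If two false twins of `u` have the same color in a strong conflict-free vertex-connection
coloring of `G - u`, giving that color to `u` yields such a coloring of `G`. -/
theorem Connected.isStrongCfvc_comp_collapseTwin (hG : G.Connected) (h₁ : w₁ ≠ u) (h₂ : w₂ ≠ u)
    (hN₁ : G.neighborSet w₁ = G.neighborSet u) (hN₂ : G.neighborSet w₂ = G.neighborSet u)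
    (hne : w₁ ≠ w₂) {g : ({u}ᶜ : Set V) → α} (hgw : g ⟨w₁, h₁⟩ = g ⟨w₂, h₂⟩)
    (hg : IsStrongCfvc (G.induce {u}ᶜ) g) :
    IsStrongCfvc G (g ∘ collapseTwin h₁ hN₁) := by
  have subst_color {w : V} (hw : w ≠ u) (hN : G.neighborSet w = G.neighborSet u)
      (hgw' : g ⟨w, hw⟩ = g ⟨w₁, h₁⟩) (a : ({u}ᶜ : Set V)) :
      (g ∘ collapseTwin h₁ hN₁) (substTwin hN a) = g a := by
    by_cases ha : (a : V) = w
    · obtain rfl : a = ⟨w, hw⟩ := Subtype.ext ha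
      rw [Function.comp_apply, substTwin_self, collapseTwin_self, hgw']
    · rw [Function.comp_apply, substTwin_of_ne hN ha, collapseTwin_coe]
  have geodesic_of_ne {w y : V} (hw : w ≠ u) (hN : G.neighborSet w = G.neighborSet u)
      (hgw' : g ⟨w, hw⟩ = g ⟨w₁, h₁⟩) (hy : y ≠ u) (hwy : w ≠ y) :
      G.ConflictFreeGeodesic (g ∘ collapseTwin h₁ hN₁) u y := by
    have key := ConflictFreeGeodesic.map (hg ⟨w, hw⟩ ⟨y, hy⟩ fun h => hwy (congrArg Subtype.val h))
      (substTwin hN) (subst_color hw hN hgw')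
      (hG.dist_section _ _ (collapseTwin_substTwin hw hN) _ _)
    rwa [substTwin_self, substTwin_of_ne hN hwy.symm] at key
  have geodesic_self {y : V} (hy : y ≠ u) :
      G.ConflictFreeGeodesic (g ∘ collapseTwin h₁ hN₁) u y := by
    by_cases hwy : w₁ = y
    · exact geodesic_of_ne h₂ hN₂ hgw.symm hy (hwy ▸ hne.symm)
    · exact geodesic_of_ne h₁ hN₁ rfl hy hwy
  intro x y hxy
  by_cases hx : x = u
  · subst hx
    exact geodesic_self hxy.symm
  by_cases hy : y = u
  · subst hy
    exact (geodesic_self hx).symm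
  let incl : G.induce {u}ᶜ →g G := inducedTwinHom Subtype.val fun _ => rfl
  exact ConflictFreeGeodesic.map (hg ⟨x, hx⟩ ⟨y, hy⟩ fun h => hxy (congrArg Subtype.val h)) incl
    (fun a => congrArg g (collapseTwin_coe h₁ hN₁ a))
    (hG.dist_section (collapseTwin h₁ hN₁) incl (collapseTwin_coe h₁ hN₁) _ _)

end Twins

end SimpleGraph

/-- if a vertex `u` of a connected graph `G` has at least `k + 1` false
twins (a set `J` of at least `k + 1` vertices, not containing `u`, all with the same
open neighborhood as `u`), then `G` is strongly cfvc `k`-colorable if and only if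
`G - u` is strongly cfvc `k`-colorable. -/
theorem strongCfvcColorable_iff_deleteFalseTwin {V : Type*} (G : SimpleGraph V)
    (hG : G.Connected) (k : ℕ) (hk : 1 ≤ k) (u : V) (J : Finset V)
    (hJu : u ∉ J) (hJcard : k + 1 ≤ J.card)
    (hJ : ∀ w ∈ J, G.neighborSet w = G.neighborSet u) :
    (∃ f : V → Fin k, IsStrongCfvc G f) ↔
      (∃ f : ({u}ᶜ : Set V) → Fin k, IsStrongCfvc (G.induce {u}ᶜ) f) := by
  have hne : ∀ w ∈ J, w ≠ u := fun w hw h => hJu (h ▸ hw)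
  have hcard : Fintype.card (Fin k) < Fintype.card J := by simpa using hJcard
  constructor
  · rintro ⟨f, hf⟩
    obtain ⟨a, b, hab, hfab⟩ :=
      Fintype.exists_ne_map_eq_of_card_lt (fun w : J => f w) hcard
    exact ⟨_, hG.isStrongCfvc_comp_substTwin (hne a a.2) (hne b b.2) (hJ a a.2) (hJ b b.2)
      (fun h => hab (Subtype.ext h)) hfab hf⟩
  · rintro ⟨g, hg⟩
    obtain ⟨a, b, hab, hgab⟩ :=
      Fintype.exists_ne_map_eq_of_card_lt (fun w : J => g ⟨w, hne w w.2⟩) hcard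
    exact ⟨_, hG.isStrongCfvc_comp_collapseTwin (hne a a.2) (hne b b.2) (hJ a a.2) (hJ b b.2)
      (fun h => hab (Subtype.ext h)) hgab hg⟩
end

section
/- Strong conflict-free vertex-connection colorability is not monotone under vertex deletion: there exists a connected graph G and a vertex u of G that has a false twin in G, such that G is strongly conflict-free vertex-connection 3-colorable, G − u is connected, and G − u is not strongly conflict-free vertex-connection 3-colorable. -/
/-- The color of some index in `[i, j]` is attained by `t` at no other index of `[i, j]`. -/
def HasUniqueColor {α : Type*} (t : ℕ → α) (i j : ℕ) : Prop :=
  ∃ k ∈ Finset.Icc i j, ∀ l ∈ Finset.Icc i j, t l = t k → l = k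

instance {α : Type*} [DecidableEq α] (t : ℕ → α) (i j : ℕ) : Decidable (HasUniqueColor t i j) :=
  inferInstanceAs (Decidable (∃ k ∈ Finset.Icc i j, ∀ l ∈ Finset.Icc i j, t l = t k → l = k))

section Intervals

variable {α : Type*} [DecidableEq α]

/-- If every subinterval of `[i, j)` has a unique color and `|S|` colors are used,
then `[i, j)` has at most `2 ^ |S| - 1` elements. -/
theorem lt_add_two_pow_of_hasUniqueColor (t : ℕ → α) (n : ℕ) :
    ∀ (S : Finset α) (i j : ℕ), S.card = n → i ≤ j → (∀ k, i ≤ k → k < j → t k ∈ S) →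
      (∀ a b, i ≤ a → a ≤ b → b < j → HasUniqueColor t a b) → j < i + 2 ^ n := by
  induction n with
  | zero =>
    intro S i j hS hij hmem _
    by_contra! h
    have := hmem i le_rfl (by simp at h; omega)
    simp_all
  | succ n ih =>
    intro S i j hS hij hmem hu
    rcases hij.eq_or_lt with rfl | hij
    · simp
    obtain ⟨k, hk, huk⟩ := hu i (j - 1) le_rfl (by omega) (by omega)
    simp only [Finset.mem_Icc] at hk huk
    have hc : (S.erase (t k)).card = n := by
      rw [Finset.card_erase_of_mem (hmem k hk.1 (by omega)), hS]; rfl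
    have hne : ∀ l, i ≤ l → l < j → l ≠ k → t l ∈ S.erase (t k) := fun l h₁ h₂ h₃ =>
      Finset.mem_erase.2 ⟨fun h => h₃ (huk l ⟨h₁, by omega⟩ h), hmem l h₁ h₂⟩
    have h₁ := ih _ i k hc hk.1 (fun l _ _ => hne l (by omega) (by omega) (by omega))
      (fun a b _ _ _ => hu a b (by omega) (by omega) (by omega))
    have h₂ := ih _ (k + 1) j hc (by omega) (fun l _ _ => hne l (by omega) (by omega) (by omega))
      (fun a b _ _ _ => hu a b (by omega) (by omega) (by omega))
    rw [pow_succ]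
    omega

/-- In an interval of the extremal length `2 ^ |S| - 1`, the first and third colors agree. -/
theorem eq_add_two_of_hasUniqueColor (t : ℕ → α) (n : ℕ) :
    ∀ (S : Finset α) (i j : ℕ), S.card = n + 2 → j + 1 = i + 2 ^ (n + 2) →
      (∀ k, i ≤ k → k < j → t k ∈ S) →
      (∀ a b, i ≤ a → a ≤ b → b < j → HasUniqueColor t a b) → t i = t (i + 2) := by
  induction n with
  | zero =>
    intro S i j hS hij hmem hu
    obtain ⟨k, hk, huk⟩ := hu i (j - 1) le_rfl (by omega) (by omega)
    simp only [Finset.mem_Icc] at hk huk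
    have hc : (S.erase (t k)).card = 1 := by
      rw [Finset.card_erase_of_mem (hmem k hk.1 (by omega)), hS]
    have hne : ∀ l, i ≤ l → l < j → l ≠ k → t l ∈ S.erase (t k) := fun l h₁ h₂ h₃ =>
      Finset.mem_erase.2 ⟨fun h => h₃ (huk l ⟨h₁, by omega⟩ h), hmem l h₁ h₂⟩
    have h₁ := lt_add_two_pow_of_hasUniqueColor t 1 _ i k hc hk.1
      (fun l _ _ => hne l (by omega) (by omega) (by omega))
      (fun a b _ _ _ => hu a b (by omega) (by omega) (by omega))
    have h₂ := lt_add_two_pow_of_hasUniqueColor t 1 _ (k + 1) j hc (by omega)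
      (fun l _ _ => hne l (by omega) (by omega) (by omega))
      (fun a b _ _ _ => hu a b (by omega) (by omega) (by omega))
    exact Finset.card_le_one.1 hc.le _ (hne i le_rfl (by omega) (by omega)) _
      (hne (i + 2) (by omega) (by omega) (by omega))
  | succ n ih =>
    intro S i j hS hij hmem hu
    have hpos : 0 < 2 ^ (n + 2) := by positivity
    rw [pow_succ] at hij
    obtain ⟨k, hk, huk⟩ := hu i (j - 1) le_rfl (by omega) (by omega)
    simp only [Finset.mem_Icc] at hk huk
    have hc : (S.erase (t k)).card = n + 2 := by
      rw [Finset.card_erase_of_mem (hmem k hk.1 (by omega)), hS]; rfl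
    have hne : ∀ l, i ≤ l → l < j → l ≠ k → t l ∈ S.erase (t k) := fun l h₁ h₂ h₃ =>
      Finset.mem_erase.2 ⟨fun h => h₃ (huk l ⟨h₁, by omega⟩ h), hmem l h₁ h₂⟩
    have h₁ := lt_add_two_pow_of_hasUniqueColor t (n + 2) _ i k hc hk.1
      (fun l _ _ => hne l (by omega) (by omega) (by omega))
      (fun a b _ _ _ => hu a b (by omega) (by omega) (by omega))
    have h₂ := lt_add_two_pow_of_hasUniqueColor t (n + 2) _ (k + 1) j hc (by omega)
      (fun l _ _ => hne l (by omega) (by omega) (by omega))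
      (fun a b _ _ _ => hu a b (by omega) (by omega) (by omega))
    exact ih _ i k hc (by omega) (fun l _ _ => hne l (by omega) (by omega) (by omega))
      (fun a b _ _ _ => hu a b (by omega) (by omega) (by omega))

end Intervals

/-- The graph in which two vertices are adjacent when their levels are consecutive. -/
def levelGraph {V : Type*} (lev : V → ℕ) : SimpleGraph V where
  Adj a b := lev a + 1 = lev b ∨ lev b + 1 = lev a
  symm := ⟨fun _ _ h => h.symm⟩
  loopless := ⟨fun _ h => by omega⟩

namespace levelGraph

variable {V α : Type*} {lev : V → ℕ}

theorem connected (root : V) (hroot : ∀ a, lev a = 0 → a = root)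
    (hlev : ∀ a, lev a ≠ 0 → ∃ b, lev b + 1 = lev a) : (levelGraph lev).Connected := by
  have key : ∀ n a, lev a = n → (levelGraph lev).Reachable root a := by
    intro n
    induction n with
    | zero => intro a ha; rw [hroot a ha]
    | succ n ih =>
      intro a ha
      obtain ⟨b, hb⟩ := hlev a (by omega)
      exact (ih b (by omega)).trans (SimpleGraph.Adj.reachable (Or.inl hb))
  exact (SimpleGraph.connected_iff _).2
    ⟨fun a b => (key _ a rfl).symm.trans (key _ b rfl), ⟨root⟩⟩

theorem le_add_length {a b : V} (p : (levelGraph lev).Walk a b) : lev b ≤ lev a + p.length := by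
  induction p with
  | nil => simp
  | cons h p ih =>
    rw [SimpleGraph.Walk.length_cons]
    rcases h with h | h <;> omega

theorem map_support {a b : V} (p : (levelGraph lev).Walk a b) (hp : lev b = lev a + p.length) :
    p.support.map lev = List.range' (lev a) (p.length + 1) := by
  induction p with
  | nil => simp
  | cons h p ih =>
    have := le_add_length p
    rw [SimpleGraph.Walk.length_cons] at hp
    have h' := h.resolve_right (by omega)
    rw [SimpleGraph.Walk.support_cons, List.map_cons, ih (by omega), ← h',
      SimpleGraph.Walk.length_cons, List.range'_succ (n := p.length + 1)]

theorem conflictFree_iff {a b : V} (p : (levelGraph lev).Walk a b)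
    (hp : lev b = lev a + p.length) (f : V → α) (t : ℕ → α)
    (ht : ∀ x ∈ p.support, f x = t (lev x)) :
    ConflictFree f p ↔ HasUniqueColor t (lev a) (lev b) := by
  have hmap := map_support p hp
  have hinj : ∀ x ∈ p.support, ∀ y ∈ p.support, lev x = lev y → x = y := by
    intro x hx y hy h
    have hn : (p.support.map lev).Nodup := hmap ▸ List.nodup_range'
    exact List.inj_on_of_nodup_map hn hx hy h
  have hmem : ∀ k, k ∈ Finset.Icc (lev a) (lev b) ↔ ∃ x ∈ p.support, lev x = k := by
    intro k
    rw [← List.mem_map, hmap, List.mem_range'_1, Finset.mem_Icc]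
    omega
  constructor
  · rintro ⟨c, x, ⟨hx, rfl⟩, hu⟩
    refine ⟨lev x, (hmem _).2 ⟨x, hx, rfl⟩, fun l hl h => ?_⟩
    obtain ⟨y, hy, rfl⟩ := (hmem l).1 hl
    rw [hu y ⟨hy, by rw [ht y hy, ht x hx, h]⟩]
  · rintro ⟨k, hk, hu⟩
    obtain ⟨x, hx, rfl⟩ := (hmem k).1 hk
    refine ⟨f x, x, ⟨hx, rfl⟩, fun y hy => hinj _ hy.1 _ hx ?_⟩
    exact hu _ ((hmem _).2 ⟨y, hy.1, rfl⟩) (by rw [← ht y hy.1, ← ht x hx, hy.2])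

theorem exists_walk (r : ℕ → V) (i n : ℕ) (hr : ∀ k ≤ i + n, lev (r k) = k) :
    ∃ p : (levelGraph lev).Walk (r i) (r (i + n)),
      p.length = n ∧ ∀ x ∈ p.support, x = r (lev x) := by
  induction n with
  | zero => exact ⟨.nil, rfl, by simp [hr i le_rfl]⟩
  | succ n ih =>
    obtain ⟨p, hp, hs⟩ := ih fun k hk => hr k (by omega)
    have h : (levelGraph lev).Adj (r (i + n)) (r (i + (n + 1))) :=
      Or.inl (by rw [hr _ (by omega), hr _ le_rfl]; rfl)
    refine ⟨p.concat h, by simp [hp], fun x hx => ?_⟩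
    rw [SimpleGraph.Walk.support_concat, List.mem_append,
      List.mem_singleton] at hx
    rcases hx with hx | rfl
    · exact hs x hx
    · rw [hr _ le_rfl]

theorem dist_eq (r : ℕ → V) (i n : ℕ) (hr : ∀ k ≤ i + n, lev (r k) = k) :
    (levelGraph lev).dist (r i) (r (i + n)) = n := by
  obtain ⟨p, hp, -⟩ := exists_walk r i n hr
  obtain ⟨q, hq⟩ := p.reachable.exists_walk_length_eq_dist
  have h₁ := le_add_length q
  have h₂ := SimpleGraph.dist_le p
  rw [hr _ le_rfl, hr _ (by omega)] at h₁
  omega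

theorem exists_conflictFree_walk (f : V → α) (r : ℕ → V) (i n : ℕ)
    (hr : ∀ k ≤ i + n, lev (r k) = k) (hu : HasUniqueColor (f ∘ r) i (i + n)) :
    ∃ p : (levelGraph lev).Walk (r i) (r (i + n)), p.IsPath ∧
      p.length = (levelGraph lev).dist (r i) (r (i + n)) ∧ ConflictFree f p := by
  obtain ⟨p, hp, hs⟩ := exists_walk r i n hr
  have hd : p.length = (levelGraph lev).dist (r i) (r (i + n)) := by rw [dist_eq r i n hr, hp]
  refine ⟨p, p.isPath_of_length_eq_dist hd, hd, ?_⟩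
  have hi := hr i (by omega)
  have hj := hr _ le_rfl
  rw [conflictFree_iff p (by omega) f (f ∘ r) fun x hx => congrArg f (hs x hx), hi, hj]
  exact hu

theorem hasUniqueColor_of_isStrongCfvc {f : V → α} (hf : IsStrongCfvc (levelGraph lev) f)
    (r : ℕ → V) {i j : ℕ} (hij : i ≤ j) (hr : ∀ k ≤ j, lev (r k) = k)
    (ht : ∀ x, i < lev x → f x = f (r (lev x))) : HasUniqueColor (f ∘ r) i j := by
  rcases hij.eq_or_lt with rfl | hlt
  · exact ⟨i, by simp, fun l hl _ => by simpa using hl⟩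
  obtain ⟨n, rfl⟩ := Nat.exists_eq_add_of_le hij
  have hi := hr i (by omega)
  have hj := hr _ le_rfl
  obtain ⟨p, -, hp, hc⟩ := hf (r i) (r (i + n)) fun h => by
    rw [h] at hi; omega
  rw [dist_eq r i n hr] at hp
  have hlen : lev (r (i + n)) = lev (r i) + p.length := by omega
  have hmap := map_support p hlen
  have hn : (p.support.map lev).Nodup := hmap ▸ List.nodup_range'
  rw [conflictFree_iff p hlen f (f ∘ r) ?_, hi, hj] at hc
  · exact hc
  intro x hx
  have hx' := List.mem_map_of_mem (f := lev) hx
  rw [hmap, List.mem_range'_1, hi] at hx'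
  rcases hx'.1.eq_or_lt with h | h
  · have := List.inj_on_of_nodup_map hn hx p.start_mem_support (h.symm.trans hi.symm)
    simp [this, hi]
  · exact ht x h

end levelGraph

theorem ConflictFree.reverse {V α : Type*} {G : SimpleGraph V} {f : V → α} {u v : V}
    {p : G.Walk u v} (h : ConflictFree f p) : ConflictFree f p.reverse := by
  simpa [ConflictFree] using h

/-- Levels of a 4-cycle `0 1 3 2` with a pendant path `3 4 5 6 7 8` and a false twin `9`
of `4`. -/
def cycleTailLevel : Fin 10 → ℕ := ![0, 1, 1, 2, 3, 4, 5, 6, 7, 3]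

/-- The geodesic through all levels that uses `x` on level `1` and `y` on level `3`. -/
def cycleTailRoute (x y : Fin 10) : ℕ → Fin 10
  | 0 => 0
  | 1 => x
  | 2 => 3
  | 3 => y
  | 4 => 5
  | 5 => 6
  | 6 => 7
  | _ => 8

/-- A strong conflict-free vertex-connection coloring of the graph with twins. -/
def cycleTailColoring : Fin 10 → Fin 3 := ![0, 1, 2, 0, 1, 0, 1, 2, 0, 2]

theorem isStrongCfvc_cycleTailColoring :
    IsStrongCfvc (levelGraph cycleTailLevel) cycleTailColoring := by
  have route : ∀ a b : Fin 10, cycleTailLevel a < cycleTailLevel b →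
      ∃ x y : Fin 10, cycleTailLevel x = 1 ∧ cycleTailLevel y = 3 ∧
        cycleTailRoute x y (cycleTailLevel a) = a ∧ cycleTailRoute x y (cycleTailLevel b) = b ∧
        HasUniqueColor (cycleTailColoring ∘ cycleTailRoute x y)
          (cycleTailLevel a) (cycleTailLevel b) := by
    decide
  have level_route : ∀ x y : Fin 10, cycleTailLevel x = 1 → cycleTailLevel y = 3 →
      ∀ k ≤ 7, cycleTailLevel (cycleTailRoute x y k) = k := by
    intro x y hx hy k hk
    interval_cases k <;> first | assumption | rfl
  have le_seven : ∀ a, cycleTailLevel a ≤ 7 := by decide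
  have lt : ∀ a b : Fin 10, cycleTailLevel a < cycleTailLevel b →
      ∃ p : (levelGraph cycleTailLevel).Walk a b, p.IsPath ∧
        p.length = (levelGraph cycleTailLevel).dist a b ∧ ConflictFree cycleTailColoring p := by
    intro a b hab
    obtain ⟨x, y, hx, hy, ha, hb, hu⟩ := route a b hab
    obtain ⟨n, hn⟩ := Nat.exists_eq_add_of_le hab.le
    have hb7 := le_seven b
    rw [hn] at hb hu hb7
    have := levelGraph.exists_conflictFree_walk cycleTailColoring (cycleTailRoute x y) _ n
      (fun k hk => level_route x y hx hy k (by omega)) hu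
    rwa [ha, hb] at this
  intro a b hab
  rcases lt_trichotomy (cycleTailLevel a) (cycleTailLevel b) with h | h | h
  · exact lt a b h
  · have twins : ∀ a b : Fin 10, a ≠ b → cycleTailLevel a = cycleTailLevel b →
        ∃ m, cycleTailLevel a + 1 = cycleTailLevel m ∧ a ≠ m ∧ b ≠ m ∧
          cycleTailColoring a ≠ cycleTailColoring b ∧
          cycleTailColoring a ≠ cycleTailColoring m := by
      decide
    obtain ⟨m, hm, ham, hbm, hcab, hcam⟩ := twins a b hab h
    have had : (levelGraph cycleTailLevel).Adj a m := Or.inl hm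
    have hbd : (levelGraph cycleTailLevel).Adj m b := Or.inr (h ▸ hm)
    let p : (levelGraph cycleTailLevel).Walk a b := .cons had (.cons hbd .nil)
    have hd : p.length = (levelGraph cycleTailLevel).dist a b := by
      have h₀ : (levelGraph cycleTailLevel).dist a b ≠ 0 :=
        fun h₀ => hab (p.reachable.dist_eq_zero_iff.1 h₀)
      have h₁ : (levelGraph cycleTailLevel).dist a b ≠ 1 := fun h₁ => by
        rcases SimpleGraph.dist_eq_one_iff_adj.1 h₁ with h' | h' <;> omega
      have h₂ : (levelGraph cycleTailLevel).dist a b ≤ 2 := SimpleGraph.dist_le p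
      change 2 = _
      omega
    refine ⟨p, p.isPath_of_length_eq_dist hd, hd, cycleTailColoring a, a, by simp [p], ?_⟩
    rintro x ⟨hx, hxa⟩
    have hx' : x = a ∨ x = m ∨ x = b := by simpa [p] using hx
    rcases hx' with rfl | rfl | rfl
    · rfl
    · exact absurd hxa.symm hcam
    · exact absurd hxa.symm hcab
  · obtain ⟨p, hp, hd, hc⟩ := lt b a h
    exact ⟨p.reverse, hp.reverse, by rw [p.length_reverse, hd, SimpleGraph.dist_comm], hc.reverse⟩

theorem not_isStrongCfvc_induce_cycleTail (f : ({9}ᶜ : Set (Fin 10)) → Fin 3) :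
    ¬ IsStrongCfvc (levelGraph fun x : ({9}ᶜ : Set (Fin 10)) => cycleTailLevel x) f := by
  intro hf
  have mem : ∀ x : Fin 10, x ≠ 9 → ∀ k, cycleTailRoute x 4 k ∈ ({9}ᶜ : Set (Fin 10)) := by
    intro x hx k
    unfold cycleTailRoute
    split <;> simp [hx]
  let r (x : Fin 10) (hx : x ≠ 9) (k : ℕ) : ({9}ᶜ : Set (Fin 10)) :=
    ⟨cycleTailRoute x 4 k, mem x hx k⟩
  have hr : ∀ x hx, cycleTailLevel x = 1 → ∀ k ≤ 7, cycleTailLevel (r x hx k) = k := by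
    intro x hx h k hk
    interval_cases k <;> first | assumption | rfl
  have eq_route : ∀ x hx, ∀ a : ({9}ᶜ : Set (Fin 10)), 1 < cycleTailLevel a →
      a = r x hx (cycleTailLevel a) := by
    rintro x hx ⟨a, ha⟩ h
    have key : ∀ x a, a ≠ 9 → 1 < cycleTailLevel a → a = cycleTailRoute x 4 (cycleTailLevel a) := by
      decide
    exact Subtype.ext (key x a ha h)
  have huniq : ∀ x hx, cycleTailLevel x = 1 → ∀ a b, 1 ≤ a → a ≤ b → b < 8 →
      HasUniqueColor (f ∘ r x hx) a b := fun x hx h a b ha hab hb =>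
    levelGraph.hasUniqueColor_of_isStrongCfvc hf (r x hx) hab
      (fun k hk => hr x hx h k (by omega))
      (fun y hy => congrArg f (eq_route x hx y (by omega)))
  have third : ∀ x hx, cycleTailLevel x = 1 → f ⟨x, hx⟩ = f (r x hx 3) := fun x hx h =>
    eq_add_two_of_hasUniqueColor (f ∘ r x hx) 1 Finset.univ 1 8 rfl rfl
      (fun _ _ _ => Finset.mem_univ _) (huniq x hx h)
  have h12 : f ⟨1, by decide⟩ = f ⟨2, by decide⟩ :=
    (third 1 (by decide) rfl).trans (third 2 (by decide) rfl).symm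
  have hroute : ∀ a : ({9}ᶜ : Set (Fin 10)), 0 < cycleTailLevel a →
      f a = f (r 1 (by decide) (cycleTailLevel a)) := by
    rintro ⟨a, ha⟩ h
    by_cases h1 : 1 < cycleTailLevel a
    · exact congrArg f (eq_route 1 (by decide) ⟨a, ha⟩ h1)
    have cases12 : ∀ a, cycleTailLevel a = 1 → a = 1 ∨ a = 2 := by decide
    have hone : cycleTailLevel a = 1 := by
      change 0 < cycleTailLevel a at h
      omega
    rcases cases12 a hone with rfl | rfl
    · rfl
    · exact h12.symm
  have hlong : 8 < 0 + 2 ^ 3 :=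
    lt_add_two_pow_of_hasUniqueColor (f ∘ r 1 (by decide)) 3 Finset.univ 0 8 rfl
      (by omega) (fun _ _ _ => Finset.mem_univ _) fun a b _ hab hb =>
        levelGraph.hasUniqueColor_of_isStrongCfvc hf (r 1 (by decide)) hab
          (fun k hk => hr 1 (by decide) rfl k (by omega)) (fun y hy => hroute y (by omega))
  omega

/-- strong conflict-free vertex-connection colorability is not monotone
under vertex deletion: there is a connected graph `G` with a vertex `u` having a false
twin `v`, such that `G` is strongly cfvc 3-colorable, `G - u` is connected, and `G - u`
is not strongly cfvc 3-colorable. -/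
theorem strongCfvc_not_monotone :
    ∃ (n : ℕ) (G : SimpleGraph (Fin n)) (u v : Fin n),
      G.Connected ∧ u ≠ v ∧ G.neighborSet u = G.neighborSet v ∧
      (∃ f : Fin n → Fin 3, IsStrongCfvc G f) ∧
      (G.induce {u}ᶜ).Connected ∧
      ¬ ∃ f : ({u}ᶜ : Set (Fin n)) → Fin 3, IsStrongCfvc (G.induce {u}ᶜ) f := by
  refine ⟨10, levelGraph cycleTailLevel, 9, 4, ?_, by decide, rfl,
    ⟨_, isStrongCfvc_cycleTailColoring⟩, ?_, fun ⟨f, hf⟩ => not_isStrongCfvc_induce_cycleTail f hf⟩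
  · exact levelGraph.connected 0 (by decide) (by decide)
  · refine levelGraph.connected (lev := fun x : ({9}ᶜ : Set (Fin 10)) => cycleTailLevel x)
      ⟨0, by decide⟩ ?_ ?_
    · rintro ⟨a, ha⟩ h
      have : ∀ a, cycleTailLevel a = 0 → a = 0 := by decide
      exact Subtype.ext (this a h)
    · rintro ⟨a, ha⟩ h
      have : ∀ a, cycleTailLevel a ≠ 0 → ∃ b, b ≠ 9 ∧ cycleTailLevel b + 1 = cycleTailLevel a := by
        decide
      obtain ⟨b, hb, hab⟩ := this a h
      exact ⟨⟨b, hb⟩, hab⟩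
end

section
/- Let G be a connected graph and X a vertex cover of G. Then G is strongly conflict-free vertex-connection (|X| + 1)-colorable; in particular, the strong conflict-free vertex-connection number of G is at most its vertex cover number plus one. Indeed, the coloring assigning a distinct color from {1,...,|X|} to each vertex of X and the color |X| + 1 to every vertex outside X is a strong cfvc (|X| + 1)-coloring of G. -/
/-- If every edge meets `X`, and `g` is injective on `X` with no color of `X` repeated outside `X`,
then every walk between distinct vertices is conflict-free. -/
theorem ConflictFree.of_vertexCover {V α : Type*} {G : SimpleGraph V} {X : Set V}
    (hX : ∀ x y : V, x ∉ X → y ∉ X → ¬ G.Adj x y) {g : V → α} (hinj : Set.InjOn g X)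
    (hne : ∀ x ∈ X, ∀ y ∉ X, g y ≠ g x) {u v : V} (huv : u ≠ v) (p : G.Walk u v) :
    ConflictFree g p := by
  obtain ⟨x, hxp, hxX⟩ : ∃ x ∈ p.support, x ∈ X := by
    cases p with
    | nil => exact absurd rfl huv
    | @cons _ w _ h q =>
      by_contra! hc
      exact hX u w (hc u (by simp)) (hc w (by simp)) h
  refine ⟨g x, x, ⟨hxp, rfl⟩, fun y hy => ?_⟩
  by_cases hyX : y ∈ X
  · exact hinj hyX hxX hy.2
  · exact absurd hy.2 (hne x hxX y hyX)

/-- A finite set can be colored injectively by `0, ..., |X| - 1`, leaving the color `|X|` for its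
complement. -/
theorem Finset.exists_injOn_coloring {V : Type*} (X : Finset V) :
    ∃ g : V → Fin (X.card + 1), Set.InjOn g ↑X ∧
      (∀ x ∈ X, (g x : ℕ) < X.card) ∧ (∀ x ∉ X, (g x : ℕ) = X.card) := by
  classical
  refine ⟨fun x => if h : x ∈ X then (X.equivFin ⟨x, h⟩).castSucc else Fin.last _,
    fun x hx y hy hxy => ?_, fun x hx => ?_, fun x hx => ?_⟩
  · rw [Finset.mem_coe] at hx hy
    simpa [hx, hy] using hxy
  · simp [hx]
  · simp [hx]

/-- if `X` is a vertex cover of a connected graph `G`, then `G` is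
strongly cfvc `(|X| + 1)`-colorable; indeed, any coloring assigning distinct colors
from `{0, ..., |X| - 1}` to the vertices of `X` and the color `|X|` to all vertices
outside `X` is a strong cfvc `(|X| + 1)`-coloring. -/
theorem strongCfvc_of_vertexCover {V : Type*} (G : SimpleGraph V) (hG : G.Connected)
    (X : Finset V) (hX : ∀ x y : V, x ∉ X → y ∉ X → ¬ G.Adj x y) :
    (∃ f : V → Fin (X.card + 1), IsStrongCfvc G f) ∧
    (∀ g : V → Fin (X.card + 1), Set.InjOn g ↑X →
      (∀ x ∈ X, (g x : ℕ) < X.card) → (∀ x ∉ X, (g x : ℕ) = X.card) →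
      IsStrongCfvc G g) := by
  have key : ∀ g : V → Fin (X.card + 1), Set.InjOn g ↑X →
      (∀ x ∈ X, (g x : ℕ) < X.card) → (∀ x ∉ X, (g x : ℕ) = X.card) →
      IsStrongCfvc G g := by
    intro g hinj hlt heq u v huv
    obtain ⟨p, hp, hlen⟩ := hG.exists_path_of_dist u v
    refine ⟨p, hp, hlen, .of_vertexCover (X := (X : Set V)) (by simpa using hX) hinj ?_ huv p⟩
    intro x hx y hy hxy
    have h := hlt x hx
    rw [← hxy, heq y hy] at h
    exact lt_irrefl _ h
  obtain ⟨g, hinj, hlt, heq⟩ := X.exists_injOn_coloring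
  exact ⟨⟨g, key g hinj hlt heq⟩, key⟩
end

section
/- Let U be a finite nonempty variable set and 𝒞 a finite nonempty collection of clauses, each clause a subset of U of size at least 2. Let f be any strong conflict-free vertex-connection 3-coloring of G(U,𝒞) with colors {0,1,2} satisfying f(h_1) = 2. Then for every clause C ∈ 𝒞 there exist variables x, y ∈ C with f(x) = 0 and f(y) = 1; that is, the variable vertices of each clause do not all receive the same color. -/
/-- The vertex type of the gadget graph `G(U, 𝒞)`: a vertex for each variable in `U`,
a vertex for each clause in `C`, and 21 extra vertices `a_1, ..., a_7`,
`b_1, ..., b_7`, `h_1, ..., h_7` (indexed here by `Fin 7`, so `A 0` is `a_1`, etc.). -/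
inductive GV (U C : Type) : Type
  | var : U → GV U C
  | cls : C → GV U C
  | A : Fin 7 → GV U C
  | B : Fin 7 → GV U C
  | H : Fin 7 → GV U C

/-- The edges of the gadget graph `G(U, 𝒞)` (given as a relation, to be
symmetrized): `h_i a_i`, `a_i h_{i+1}`, `h_{i+1} b_i`, `b_i h_i` for `1 ≤ i ≤ 6`;
`h_7 a_7` and `h_7 b_7`; an edge between clause vertex `c` and variable vertex `v`
whenever `v ∈ c`; edges `a_7 c` and `b_7 c` for every clause `c ∈ 𝒞`; and edges
`h_1 v` for every variable `v ∈ U`. -/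
def gadgetRel {U : Type} (𝒞 : Finset (Finset U)) :
    GV U {C : Finset U // C ∈ 𝒞} → GV U {C : Finset U // C ∈ 𝒞} → Prop
  | .H i, .A j => i = j ∨ i.val = j.val + 1
  | .H i, .B j => i = j ∨ i.val = j.val + 1
  | .cls c, .var v => v ∈ c.val
  | .A i, .cls _ => i.val = 6
  | .B i, .cls _ => i.val = 6
  | .H i, .var _ => i.val = 0
  | _, _ => False

/-- The gadget graph `G(U, 𝒞)` of the reduction from positive NAE-SAT. -/
def gadgetGraph {U : Type} (𝒞 : Finset (Finset U)) :
    SimpleGraph (GV U {C : Finset U // C ∈ 𝒞}) :=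
  SimpleGraph.fromRel (gadgetRel 𝒞)

/-- Some choice of one color from each palette in `L` has a color occurring exactly once. -/
def hasConflictFreeChoice (L : List (List (Fin 3))) : Bool :=
  L.sections.any fun l => [0, 1, 2].any fun c => l.count c == 1

/-- The palette `p` may follow the palettes `r` (most recent first): every color of `p` is joined
to every color of each of the last seven palettes by a conflict-free choice of colors. -/
def extendsPalettes (r : List (List (Fin 3))) (p : List (Fin 3)) : Bool :=
  (List.range 7).all fun k => (r.getD k []).all fun s => p.all fun e =>
    hasConflictFreeChoice ([e] :: (r.take k ++ [[s]]))

/-- The stages of the cyclic arrangement of the gadget graph in which only one color occurs,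
provided that the chosen clause is monochromatic. -/
def isMonoStage (n : ℕ) : Bool :=
  n == 1 || n == 17 || (n % 2 == 0 && n != 16)

/-- The possible palettes at stage `n`. -/
def paletteOptions (n : ℕ) : List (List (Fin 3)) :=
  [0, 1, 2].sublists.filter fun p => if isMonoStage n then p.length == 1 else p.length != 0

/-- The sequences of `n` palettes, most recent first, all of whose windows of length at most eight
admit conflict-free choices. -/
def paletteSequences : ℕ → List (List (List (Fin 3)))
  | 0 => [[]]
  | n + 1 => (paletteSequences n).flatMap fun r =>
      ((paletteOptions n).filter (extendsPalettes r)).map (· :: r)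

theorem paletteSequences_not_closed :
    ∀ r ∈ paletteSequences 18,
      ¬ (r.getD 16 [] = r.getD 0 [] ∧ ∀ c ∈ r.getD 17 [], c ∈ r.getD 1 []) := by
  decide +kernel

/-- The list `[P (n - 1), ..., P 0]`. -/
def revPrefix (P : ℕ → List (Fin 3)) : ℕ → List (List (Fin 3))
  | 0 => []
  | n + 1 => P n :: revPrefix P n

theorem length_revPrefix (P : ℕ → List (Fin 3)) (n : ℕ) : (revPrefix P n).length = n := by
  induction n with
  | zero => rfl
  | succ n ih => simp [revPrefix, ih]

theorem getElem_revPrefix (P : ℕ → List (Fin 3)) (n k : ℕ) (hk : k < (revPrefix P n).length) :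
    (revPrefix P n)[k] = P (n - 1 - k) := by
  induction n generalizing k with
  | zero => simp [revPrefix] at hk
  | succ n ih =>
    cases k with
    | zero => simp [revPrefix]
    | succ k =>
      simp only [revPrefix, List.getElem_cons_succ]
      rw [ih]
      congr 1
      omega

theorem revPrefix_mem_paletteSequences (P : ℕ → List (Fin 3)) (N : ℕ)
    (hopt : ∀ n < N, P n ∈ paletteOptions n)
    (hext : ∀ n < N, extendsPalettes (revPrefix P n) (P n) = true) :
    revPrefix P N ∈ paletteSequences N := by
  induction N with
  | zero => simp [revPrefix, paletteSequences]
  | succ N ih =>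
    simp only [paletteSequences, List.mem_flatMap, List.mem_map, List.mem_filter]
    exact ⟨revPrefix P N, ih (fun n hn => hopt n (by omega)) (fun n hn => hext n (by omega)),
      P N, ⟨hopt N (by omega), hext N (by omega)⟩, rfl⟩

theorem List.Nodup.eq_singleton_of_forall_eq {α : Type*} {l : List α} {a : α} (hl : l.Nodup)
    (ha : a ∈ l) (h : ∀ b ∈ l, b = a) : l = [a] := by
  rw [← List.perm_singleton, List.perm_ext_iff_of_nodup hl (List.nodup_singleton a)]
  intro b
  simp only [List.mem_singleton]
  exact ⟨h b, fun hb => hb ▸ ha⟩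

theorem ConflictFree.exists_count_eq_one {V α : Type*} [DecidableEq α] {G : SimpleGraph V}
    {f : V → α} {u v : V} {p : G.Walk u v} (h : ConflictFree f p) (hp : p.IsPath) :
    ∃ c, (p.support.map f).count c = 1 := by
  obtain ⟨c, x, ⟨hx, hxc⟩, huniq⟩ := h
  refine ⟨c, ?_⟩
  have h1 : p.support.filter (fun y => f y == c) = [x] := by
    refine (hp.support_nodup.filter _).eq_singleton_of_forall_eq ?_ ?_
    · simp [hx, hxc]
    · intro b hb
      simp only [List.mem_filter, beq_iff_eq] at hb
      exact huniq b hb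
  rw [List.count, List.countP_map, List.countP_eq_length_filter]
  simpa [Function.comp_def] using congrArg List.length h1

section Stages

variable {U : Type} {𝒞 : Finset (Finset U)}

/-- The position of a vertex in the cyclic arrangement of the gadget graph in 16 layers. -/
def layer {C : Type} : GV U C → ℕ
  | .cls _ => 0
  | .var _ => 1
  | .H i => 2 * i.val + 2
  | .A i => 2 * i.val + 3
  | .B i => 2 * i.val + 3

/-- The cyclic arrangement cut open at the clause `c₀`: going once around the cycle leads from
`c₀` through its variables, the vertices `h_i`, `a_i`, `b_i`, and the clauses that contain `x₀`
to the variable `x₀`. -/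
def Stage (c₀ : {C : Finset U // C ∈ 𝒞}) (x₀ : U) (n : ℕ) :
    GV U {C : Finset U // C ∈ 𝒞} → Prop
  | .cls c => n = 0 ∧ c = c₀ ∨ n = 16 ∧ x₀ ∈ c.val
  | .var x => n = 1 ∧ x ∈ c₀.val ∨ n = 17 ∧ x = x₀
  | .H i => n = 2 * i.val + 2
  | .A i => n = 2 * i.val + 3
  | .B i => n = 2 * i.val + 3

theorem gadgetGraph_adj {u v : GV U {C : Finset U // C ∈ 𝒞}} :
    (gadgetGraph 𝒞).Adj u v ↔ gadgetRel 𝒞 u v ∨ gadgetRel 𝒞 v u := by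
  rw [gadgetGraph, SimpleGraph.fromRel_adj, and_iff_right_iff_imp]
  rintro h rfl
  cases u <;> simp [gadgetRel] at h

theorem layer_of_adj {u v : GV U {C : Finset U // C ∈ 𝒞}} (h : (gadgetGraph 𝒞).Adj u v) :
    (16 : ℤ) ∣ layer v - layer u - 1 ∨ (16 : ℤ) ∣ layer v - layer u + 1 := by
  rw [gadgetGraph_adj] at h
  cases u <;> cases v <;> simp only [gadgetRel, layer, Fin.ext_iff, or_false, false_or] at h ⊢ <;>
    omega

theorem exists_layer_shift {u v : GV U {C : Finset U // C ∈ 𝒞}}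
    (p : (gadgetGraph 𝒞).Walk u v) :
    ∃ m : ℤ, |m| ≤ p.length ∧ (16 : ℤ) ∣ layer v - layer u - m := by
  induction p with
  | nil => exact ⟨0, by simp⟩
  | cons h p ih =>
    obtain ⟨m, hm, hdvd⟩ := ih
    rw [abs_le] at hm
    rcases layer_of_adj h with h1 | h1
    · refine ⟨m + 1, ?_, ?_⟩
      · rw [abs_le, SimpleGraph.Walk.length_cons]
        push_cast
        omega
      · omega
    · refine ⟨m - 1, ?_, ?_⟩
      · rw [abs_le, SimpleGraph.Walk.length_cons]
        push_cast
        omega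
      · omega

variable {c₀ : {C : Finset U // C ∈ 𝒞}} {x₀ : U}

theorem Stage.layer_dvd {n : ℕ} {w : GV U {C : Finset U // C ∈ 𝒞}} (h : Stage c₀ x₀ n w) :
    (16 : ℤ) ∣ n - layer w := by
  cases w <;> simp only [Stage, layer] at h ⊢ <;> omega

theorem Stage.adj {n : ℕ} {u v : GV U {C : Finset U // C ∈ 𝒞}}
    (hu : Stage c₀ x₀ (n + 1) u) (hv : Stage c₀ x₀ n v) : (gadgetGraph 𝒞).Adj u v := by
  rw [gadgetGraph_adj]
  cases u <;> cases v <;>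
    simp only [Stage, gadgetRel, Fin.ext_iff, or_false, false_or] at hu hv ⊢ <;>
    first
      | omega
      | grind

theorem exists_stage (hx₀ : x₀ ∈ c₀.val) {n : ℕ} (hn : n < 18) :
    ∃ w, Stage c₀ x₀ n w := by
  by_cases h0 : n = 0
  · exact ⟨.cls c₀, .inl ⟨h0, rfl⟩⟩
  by_cases h1 : n = 1
  · exact ⟨.var x₀, .inl ⟨h1, hx₀⟩⟩
  by_cases h16 : n = 16
  · exact ⟨.cls c₀, .inr ⟨h16, hx₀⟩⟩
  by_cases h17 : n = 17
  · exact ⟨.var x₀, .inr ⟨h17, rfl⟩⟩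
  rcases Nat.even_or_odd' n with ⟨k, rfl | rfl⟩
  · exact ⟨.H ⟨k - 1, by omega⟩, by simp only [Stage]; omega⟩
  · exact ⟨.A ⟨k - 1, by omega⟩, by simp only [Stage]; omega⟩

theorem Stage.exists_walk (hx₀ : x₀ ∈ c₀.val) {i d : ℕ} (hd : i + d + 1 < 18)
    {u v : GV U {C : Finset U // C ∈ 𝒞}} (hu : Stage c₀ x₀ (i + d + 1) u)
    (hv : Stage c₀ x₀ i v) : ∃ p : (gadgetGraph 𝒞).Walk u v, p.length = d + 1 := by
  induction d generalizing u with
  | zero => exact ⟨(hu.adj hv).toWalk, by simp⟩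
  | succ d ih =>
    obtain ⟨w, hw⟩ := exists_stage hx₀ (n := i + d + 1) (by omega)
    obtain ⟨p, hp⟩ := ih (by omega) hw
    exact ⟨.cons (Stage.adj hu hw) p, by simp [hp]⟩

theorem Stage.length_eq {i d : ℕ} (hd : d ≤ 7) {u v : GV U {C : Finset U // C ∈ 𝒞}}
    (hu : Stage c₀ x₀ (i + d) u) (hv : Stage c₀ x₀ i v) (p : (gadgetGraph 𝒞).Walk u v)
    (hp : p.length ≤ d) : p.length = d := by
  obtain ⟨m, hm, hdvd⟩ := exists_layer_shift p
  rw [abs_le] at hm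
  have h1 := hu.layer_dvd
  have h2 := hv.layer_dvd
  push_cast at h1
  omega

theorem Stage.getVert {i d : ℕ} (hd : d ≤ 7) (hid : i + d < 18)
    {u v : GV U {C : Finset U // C ∈ 𝒞}} (hu : Stage c₀ x₀ (i + d) u)
    (hv : Stage c₀ x₀ i v) (p : (gadgetGraph 𝒞).Walk u v) (hp : p.length = d)
    {k : ℕ} (hk : k ≤ d) : Stage c₀ x₀ (i + d - k) (p.getVert k) := by
  have hlayer : (16 : ℤ) ∣ ((i + d - k : ℕ) : ℤ) - layer (p.getVert k) := by
    obtain ⟨m₁, hm₁, hdvd₁⟩ := exists_layer_shift (p.take k)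
    obtain ⟨m₂, hm₂, hdvd₂⟩ := exists_layer_shift (p.drop k)
    rw [abs_le] at hm₁ hm₂
    rw [SimpleGraph.Walk.take_length] at hm₁
    rw [SimpleGraph.Walk.drop_length] at hm₂
    have h1 := hu.layer_dvd
    have h2 := hv.layer_dvd
    push_cast at h1
    omega
  have hzero : k = 0 → p.getVert k = u := by rintro rfl; simp
  have hlast : k = d → p.getVert k = v := by rintro rfl; simp [← hp]
  have hnext : k < d → (gadgetGraph 𝒞).Adj (p.getVert k) (p.getVert (k + 1)) :=
    fun h => p.adj_getVert_succ (by omega)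
  by_cases hk0 : k = 0
  · rw [hzero hk0]
    simpa [hk0] using hu
  by_cases hkd : k = d
  · rw [hlast hkd]
    simpa [hkd] using hv
  have hprev : (gadgetGraph 𝒞).Adj (p.getVert (k - 1)) (p.getVert k) := by
    have := p.adj_getVert_succ (i := k - 1) (by omega)
    rwa [Nat.sub_add_cancel (by omega)] at this
  have hnext := hnext (by omega)
  cases hw : p.getVert k with
  | cls c =>
    rw [hw] at hlayer hprev
    simp only [layer] at hlayer
    have h16 : i + d - k = 16 := by omega
    have hk1 : k - 1 = 0 := by omega
    rw [hk1, SimpleGraph.Walk.getVert_zero, gadgetGraph_adj] at hprev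
    have h17 : i + d = 17 := by omega
    rw [h17] at hu
    refine .inr ⟨h16, ?_⟩
    cases u <;> simp only [Stage, gadgetRel] at hu hprev <;> first | omega | grind
  | var x =>
    rw [hw] at hlayer hnext
    simp only [layer] at hlayer
    have h1 : i + d - k = 1 := by omega
    have hk1 : k + 1 = p.length := by omega
    rw [hk1, SimpleGraph.Walk.getVert_length, gadgetGraph_adj] at hnext
    have h0 : i = 0 := by omega
    rw [h0] at hv
    refine .inl ⟨h1, ?_⟩
    cases v <;> simp only [Stage, gadgetRel] at hv hnext <;> first | omega | grind
  | H i => rw [hw] at hlayer; simp only [layer, Stage] at hlayer ⊢; omega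
  | A i => rw [hw] at hlayer; simp only [layer, Stage] at hlayer ⊢; omega
  | B i => rw [hw] at hlayer; simp only [layer, Stage] at hlayer ⊢; omega

open Classical in
/-- The colors that occur at stage `n`. -/
noncomputable def palette (c₀ : {C : Finset U // C ∈ 𝒞}) (x₀ : U)
    (f : GV U {C : Finset U // C ∈ 𝒞} → Fin 3) (n : ℕ) : List (Fin 3) :=
  [0, 1, 2].filter fun c => ∃ w, Stage c₀ x₀ n w ∧ f w = c

variable {f : GV U {C : Finset U // C ∈ 𝒞} → Fin 3}

theorem mem_palette {n : ℕ} {c : Fin 3} :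
    c ∈ palette c₀ x₀ f n ↔ ∃ w, Stage c₀ x₀ n w ∧ f w = c := by
  have : c ∈ ([0, 1, 2] : List (Fin 3)) := by fin_cases c <;> simp
  simp [palette, List.mem_filter, this]

theorem palette_eq_singleton (hx₀ : x₀ ∈ c₀.val) {n : ℕ} (hn : n < 18) {c : Fin 3}
    (h : ∀ w, Stage c₀ x₀ n w → f w = c) : palette c₀ x₀ f n = [c] := by
  obtain ⟨w, hw⟩ := exists_stage hx₀ hn
  refine List.Nodup.eq_singleton_of_forall_eq (List.Nodup.filter _ (by decide))
    (mem_palette.2 ⟨w, hw, h w hw⟩) ?_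
  intro b hb
  obtain ⟨w', hw', rfl⟩ := mem_palette.1 hb
  exact h w' hw'

theorem palette_mem_paletteOptions (hx₀ : x₀ ∈ c₀.val)
    (hmono : ∀ x ∈ c₀.val, f (.var x) = f (.var x₀)) {n : ℕ} (hn : n < 18) :
    palette c₀ x₀ f n ∈ paletteOptions n := by
  obtain ⟨w₀, hw₀⟩ := exists_stage hx₀ hn
  rw [paletteOptions, List.mem_filter, List.mem_sublists]
  refine ⟨List.filter_sublist, ?_⟩
  split_ifs with hm
  · have hconst : ∀ w, Stage c₀ x₀ n w → f w = f w₀ := by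
      intro w hw
      simp only [isMonoStage, Bool.or_eq_true, Bool.and_eq_true, beq_iff_eq, bne_iff_ne] at hm
      cases w <;> cases w₀ <;> simp only [Stage] at hw hw₀ <;>
        first
          | omega
          | grind
    simp [palette_eq_singleton hx₀ hn hconst]
  · have := List.ne_nil_of_mem (mem_palette.2 ⟨w₀, hw₀, rfl⟩ : f w₀ ∈ palette c₀ x₀ f n)
    simpa using this

theorem hasConflictFreeChoice_of_stage (hf : IsStrongCfvc (gadgetGraph 𝒞) f)
    (hx₀ : x₀ ∈ c₀.val) {i d : ℕ} (hd : d + 1 ≤ 7) (hid : i + d + 1 < 18)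
    {u v : GV U {C : Finset U // C ∈ 𝒞}} (hu : Stage c₀ x₀ (i + d + 1) u)
    (hv : Stage c₀ x₀ i v) :
    hasConflictFreeChoice
      ([f u] :: ((revPrefix (palette c₀ x₀ f) (i + d + 1)).take d ++ [[f v]])) = true := by
  have hne : u ≠ v := by
    rintro rfl
    have h1 := hu.layer_dvd
    have h2 := hv.layer_dvd
    push_cast at h1
    omega
  obtain ⟨p, hpath, hdist, hcf⟩ := hf u v hne
  have hlen : p.length = d + 1 := by
    obtain ⟨q, hq⟩ := hu.exists_walk hx₀ hid hv
    exact Stage.length_eq hd hu hv p (hdist.trans_le (hq ▸ SimpleGraph.dist_le q))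
  obtain ⟨c, hc⟩ := hcf.exists_count_eq_one hpath
  rw [hasConflictFreeChoice, List.any_eq_true]
  refine ⟨p.support.map f, ?_, ?_⟩
  · rw [List.mem_sections, List.forall₂_iff_get]
    refine ⟨by simp [hlen, length_revPrefix]; omega, fun k hk hk' => ?_⟩
    have hkd : k ≤ d + 1 := by
      simp [hlen] at hk
      omega
    simp only [List.get_eq_getElem, List.getElem_map, SimpleGraph.Walk.support_getElem_eq_getVert]
    rcases Nat.eq_zero_or_pos k with rfl | hpos
    · simp
    obtain ⟨m, rfl⟩ : ∃ m, k = m + 1 := ⟨k - 1, by omega⟩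
    rw [List.getElem_cons_succ, List.getElem_append]
    split_ifs with hm
    · rw [List.getElem_take, getElem_revPrefix, mem_palette]
      refine ⟨_, ?_, rfl⟩
      have := Stage.getVert hd hid hu hv p hlen hkd
      convert this using 1
      omega
    · have hmd : m = d := by
        simp [length_revPrefix] at hm
        omega
      have hv' : p.getVert (m + 1) = v := by rw [hmd, ← hlen, p.getVert_length]
      simp [hv']
  · rw [List.any_eq_true]
    exact ⟨c, by fin_cases c <;> simp, by simpa using hc⟩

theorem extendsPalettes_palette (hf : IsStrongCfvc (gadgetGraph 𝒞) f) (hx₀ : x₀ ∈ c₀.val)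
    {n : ℕ} (hn : n < 18) :
    extendsPalettes (revPrefix (palette c₀ x₀ f) n) (palette c₀ x₀ f n) = true := by
  simp only [extendsPalettes, List.all_eq_true, List.mem_range]
  intro k hk s hs e he
  obtain ⟨u, hu, rfl⟩ := mem_palette.1 he
  by_cases hkn : k < n
  · rw [List.getD_eq_getElem _ _ (by rwa [length_revPrefix]), getElem_revPrefix] at hs
    obtain ⟨v, hv, rfl⟩ := mem_palette.1 hs
    obtain ⟨i, rfl⟩ : ∃ i, n = i + k + 1 := ⟨n - 1 - k, by omega⟩
    rw [show i + k + 1 - 1 - k = i by omega] at hv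
    exact hasConflictFreeChoice_of_stage hf hx₀ (by omega) hn hu hv
  · rw [List.getD_eq_default _ _ (by rw [length_revPrefix]; omega)] at hs
    simp at hs

theorem exists_color_ne_of_mem_clause (hf : IsStrongCfvc (gadgetGraph 𝒞) f)
    (hx₀ : x₀ ∈ c₀.val) : ∃ x ∈ c₀.val, f (.var x) ≠ f (.var x₀) := by
  by_contra! hmono
  refine paletteSequences_not_closed _
    (revPrefix_mem_paletteSequences (palette c₀ x₀ f) 18
      (fun n hn => palette_mem_paletteOptions hx₀ hmono hn)
      (fun n hn => extendsPalettes_palette hf hx₀ hn)) ⟨?_, ?_⟩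
  · change palette c₀ x₀ f 1 = palette c₀ x₀ f 17
    rw [palette_eq_singleton hx₀ (by omega) (c := f (.var x₀)),
      palette_eq_singleton hx₀ (by omega) (c := f (.var x₀))]
    all_goals
      intro w hw
      cases w <;> simp only [Stage] at hw <;> first | omega | grind
  · change ∀ c ∈ palette c₀ x₀ f 0, c ∈ palette c₀ x₀ f 16
    intro c hc
    obtain ⟨w, hw, rfl⟩ := mem_palette.1 hc
    refine mem_palette.2 ⟨w, ?_, rfl⟩
    cases w <;> simp only [Stage] at hw ⊢ <;> first | omega | grind

end Stages

/-- if `f` is a strong conflict-free vertex-connection 3-coloring of the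
gadget graph `G(U, 𝒞)` with colors `{0, 1, 2}` and `f(h_1) = 2`, then for every clause
`C ∈ 𝒞` some variable of `C` is colored 0 and some variable of `C` is colored 1. -/
theorem gadget_clause_not_monochromatic {U : Type} [Fintype U] [Nonempty U]
    (𝒞 : Finset (Finset U)) (h𝒞 : ∀ C ∈ 𝒞, 2 ≤ C.card) (h𝒞ne : 𝒞.Nonempty)
    (f : GV U {C : Finset U // C ∈ 𝒞} → Fin 3)
    (hf : IsStrongCfvc (gadgetGraph 𝒞) f)
    (hh1 : f (GV.H 0) = 2) :
    ∀ C ∈ 𝒞, (∃ x ∈ C, f (GV.var x) = 0) ∧ (∃ y ∈ C, f (GV.var y) = 1) := by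
  intro C hC
  have hne2 : ∀ x, f (GV.var x) ≠ 2 := fun x h =>
    hf.ne_of_adj (gadgetGraph_adj.2 (.inl rfl) : (gadgetGraph 𝒞).Adj (.H 0) (.var x))
      (hh1.trans h.symm)
  obtain ⟨x, hx⟩ : C.Nonempty := Finset.card_pos.1 (by have := h𝒞 C hC; omega)
  obtain ⟨y, hy, hxy⟩ := exists_color_ne_of_mem_clause (c₀ := ⟨C, hC⟩) hf hx
  have hx2 := hne2 x
  have hy2 := hne2 y
  have hcases : f (.var x) = 0 ∧ f (.var y) = 1 ∨ f (.var x) = 1 ∧ f (.var y) = 0 := by omega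
  rcases hcases with ⟨h0, h1⟩ | ⟨h1, h0⟩
  · exact ⟨⟨x, hx, h0⟩, ⟨y, hy, h1⟩⟩
  · exact ⟨⟨y, hy, h0⟩, ⟨x, hx, h1⟩⟩
end

section
/- Let U be a finite nonempty variable set and 𝒞 a finite nonempty collection of clauses, each clause a subset of U of size at least 2. Then (U,𝒞) admits an NAE-assignment if and only if the graph G(U,𝒞) is strongly conflict-free vertex-connection 3-colorable. -/
namespace Gadget

open SimpleGraph

/-- Some color occurs exactly once in the list. -/
def hasUnique (l : List (Fin 3)) : Bool :=
  l.count 0 == 1 || l.count 1 == 1 || l.count 2 == 1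

/-- Choosing one color from every list of `L` but the last, and `t` from the last one, can produce,
together with the colors `acc` already collected, a color list with a unique color. -/
def canPick (t : Fin 3) : List (List (Fin 3)) → List (Fin 3) → Bool
  | [], _ => false
  | [_], acc => hasUnique (t :: acc)
  | m :: m' :: rest, acc => m.any fun s => canPick t (m' :: rest) (s :: acc)

/-- Whatever the colors of its two ends, the level sequence has a conflict-free choice. -/
def levelsGood : List (List (Fin 3)) → Bool
  | [] => true
  | m :: rest => m.all fun s => (rest.getLastD []).all fun t => canPick t rest [s]

/-- All initial segments with between two and eight levels are good. -/
def segmentsGood (L : List (List (Fin 3))) : Bool :=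
  (List.range 7).all fun k => decide (L.length < k + 2) || levelsGood (L.take (k + 2))

theorem four_blocks :
    ∀ e₀ a₀ b₀, segmentsGood [[a₀, b₀], [e₀]] →
    ∀ e₁, segmentsGood [[e₁], [a₀, b₀], [e₀]] →
    ∀ a₁ b₁, segmentsGood [[a₁, b₁], [e₁], [a₀, b₀], [e₀]] →
    ∀ e₂, segmentsGood [[e₂], [a₁, b₁], [e₁], [a₀, b₀], [e₀]] →
    ∀ a₂ b₂, segmentsGood [[a₂, b₂], [e₂], [a₁, b₁], [e₁], [a₀, b₀], [e₀]] →
    ∀ e₃, segmentsGood [[e₃], [a₂, b₂], [e₂], [a₁, b₁], [e₁], [a₀, b₀], [e₀]] →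
    ∀ a₃ b₃, segmentsGood [[a₃, b₃], [e₃], [a₂, b₂], [e₂], [a₁, b₁], [e₁], [a₀, b₀], [e₀]] →
    ∀ e₄, segmentsGood
      [[e₄], [a₃, b₃], [e₃], [a₂, b₂], [e₂], [a₁, b₁], [e₁], [a₀, b₀], [e₀]] →
    e₁ = e₂ ∧ e₂ = e₃ ∧ a₁ ≠ b₁ ∧ a₂ ≠ b₂ := by
  decide +kernel

theorem first_block :
    ∀ e₀ a₀ b₀, segmentsGood [[a₀, b₀], [e₀]] →
    ∀ e₁, segmentsGood [[e₁], [a₀, b₀], [e₀]] →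
    ∀ a₁ b₁, segmentsGood [[a₁, b₁], [e₁], [a₀, b₀], [e₀]] →
    ∀ e₂, segmentsGood [[e₂], [a₁, b₁], [e₁], [a₀, b₀], [e₀]] → e₁ = e₂ → a₁ ≠ b₁ →
    (e₀ = e₁ ∧ a₀ ≠ b₀ ∧ a₀ ≠ e₀ ∧ b₀ ≠ e₀) ∨ (e₀ ≠ e₁ ∧ a₀ = b₀ ∧ a₀ ≠ e₀ ∧ a₀ ≠ e₁) := by
  decide +kernel

theorem last_block :
    ∀ e₀ a₀ b₀ e₁, segmentsGood [[e₁], [a₀, b₀], [e₀]] →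
    ∀ a₁ b₁, segmentsGood [[a₁, b₁], [e₁], [a₀, b₀], [e₀]] →
    ∀ e₂, segmentsGood [[e₂], [a₁, b₁], [e₁], [a₀, b₀], [e₀]] → e₀ = e₁ → a₀ ≠ b₀ →
    (e₂ = e₁ ∧ a₁ ≠ b₁) ∨ (e₂ ≠ e₁ ∧ a₁ = b₁ ∧ a₁ ≠ e₁ ∧ a₁ ≠ e₂) := by
  decide +kernel

variable {U : Type} {𝒞 : Finset (Finset U)}

/-- The level of a vertex on the cycle of length 16 underlying the gadget graph. -/
def level {C : Type} : GV U C → ℕ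
  | .var _ => 15
  | .cls _ => 14
  | .A i => 2 * i + 1
  | .B i => 2 * i + 1
  | .H i => 2 * i

/-- `w` is a neighbor of `x` one level below. -/
def Down (𝒞 : Finset (Finset U)) (x w : GV U {C : Finset U // C ∈ 𝒞}) : Prop :=
  (gadgetGraph 𝒞).Adj x w ∧ level x = (level w + 1) % 16

theorem level_lt {C : Type} (x : GV U C) : level x < 16 := by
  cases x <;> simp only [level] <;> omega

theorem adj_iff {x y : GV U {C : Finset U // C ∈ 𝒞}} :
    (gadgetGraph 𝒞).Adj x y ↔ gadgetRel 𝒞 x y ∨ gadgetRel 𝒞 y x := by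
  refine ⟨fun h => h.2, fun h => ⟨?_, h⟩⟩
  rintro rfl
  cases x <;> simp [gadgetRel] at h

theorem level_of_adj {x y : GV U {C : Finset U // C ∈ 𝒞}} (h : (gadgetGraph 𝒞).Adj x y) :
    level x = (level y + 1) % 16 ∨ level y = (level x + 1) % 16 := by
  rw [adj_iff] at h
  cases x <;> cases y <;> simp [gadgetRel, level] at h ⊢ <;> omega

theorem down_A {i : Fin 7} {w : GV U {C : Finset U // C ∈ 𝒞}} :
    Down 𝒞 (.A i) w ↔ w = .H i := by
  cases w <;> simp [Down, adj_iff, gadgetRel, level] <;> omega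

theorem down_B {i : Fin 7} {w : GV U {C : Finset U // C ∈ 𝒞}} :
    Down 𝒞 (.B i) w ↔ w = .H i := by
  cases w <;> simp [Down, adj_iff, gadgetRel, level] <;> omega

theorem down_H_succ {i : ℕ} (hi : i + 1 < 7) {w : GV U {C : Finset U // C ∈ 𝒞}} :
    Down 𝒞 (.H ⟨i + 1, hi⟩) w ↔ w = .A ⟨i, by omega⟩ ∨ w = .B ⟨i, by omega⟩ := by
  cases w <;> simp [Down, adj_iff, gadgetRel, level, Fin.ext_iff] <;> omega

theorem down_H_zero {w : GV U {C : Finset U // C ∈ 𝒞}} :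
    Down 𝒞 (.H 0) w ↔ ∃ v, w = .var v := by
  cases w <;> simp [Down, adj_iff, gadgetRel, level] <;> omega

theorem down_var {v : U} {w : GV U {C : Finset U // C ∈ 𝒞}} :
    Down 𝒞 (.var v) w ↔ ∃ c, v ∈ c.1 ∧ w = .cls c := by
  cases w <;> simp [Down, adj_iff, gadgetRel, level]
  omega

theorem down_cls {c : {C : Finset U // C ∈ 𝒞}} {w : GV U {C : Finset U // C ∈ 𝒞}} :
    Down 𝒞 (.cls c) w ↔ w = .A 6 ∨ w = .B 6 := by
  cases w <;> simp [Down, adj_iff, gadgetRel, level, Fin.ext_iff] <;> omega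

/-- A descending chain of `n` steps from `x` to `y` exists. -/
def Descends (𝒞 : Finset (Finset U)) :
    ℕ → GV U {C : Finset U // C ∈ 𝒞} → GV U {C : Finset U // C ∈ 𝒞} → Prop
  | 0, x, y => x = y
  | n + 1, x, y => ∃ w, Down 𝒞 x w ∧ Descends 𝒞 n w y

/-- There is a descending chain of `n` steps from `x` to `y` whose colors, together with
`acc`, have a unique color. -/
def DescendsUniquely (f : GV U {C : Finset U // C ∈ 𝒞} → Fin 3) :
    ℕ → GV U {C : Finset U // C ∈ 𝒞} → GV U {C : Finset U // C ∈ 𝒞} → List (Fin 3) → Prop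
  | 0, x, y, acc => x = y ∧ hasUnique (f x :: acc)
  | n + 1, x, y, acc => ∃ w, Down 𝒞 x w ∧ DescendsUniquely f n w y (f x :: acc)

theorem Descends.exists_walk {n : ℕ} {x y : GV U {C : Finset U // C ∈ 𝒞}}
    (h : Descends 𝒞 n x y) : ∃ p : (gadgetGraph 𝒞).Walk x y, p.length = n := by
  induction n generalizing x with
  | zero => cases h; exact ⟨.nil, rfl⟩
  | succ n ih =>
    obtain ⟨w, hw, h⟩ := h
    obtain ⟨p, hp⟩ := ih h
    exact ⟨.cons hw.1 p, by simp [hp]⟩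

theorem Descends.level_eq {n : ℕ} {x y : GV U {C : Finset U // C ∈ 𝒞}}
    (h : Descends 𝒞 n x y) : level x = (level y + n) % 16 := by
  induction n generalizing x with
  | zero => subst h; have := level_lt x; omega
  | succ n ih =>
    obtain ⟨w, hw, h⟩ := h
    have := ih h
    have := hw.2
    omega

theorem le_length_of_level {x y : GV U {C : Finset U // C ∈ 𝒞}} (p : (gadgetGraph 𝒞).Walk x y)
    {m : ℕ} (hm : level x = (level y + m) % 16) (h : m + p.length < 16) : m ≤ p.length := by
  induction p generalizing m with
  | nil => simp at h ⊢; omega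
  | @cons x w y hadj q ih =>
    simp only [Walk.length_cons] at h ⊢
    have hx := level_lt x
    have hw := level_lt w
    have hy := level_lt y
    by_contra hlt
    rcases level_of_adj hadj with h1 | h1
    · have := @ih (m - 1) (by omega) (by omega)
      omega
    · have := @ih (m + 1) (by omega) (by omega)
      omega

theorem descendsUniquely_of_walk {f : GV U {C : Finset U // C ∈ 𝒞} → Fin 3}
    {x y : GV U {C : Finset U // C ∈ 𝒞}} (p : (gadgetGraph 𝒞).Walk x y) {acc : List (Fin 3)}
    (hl : level x = (level y + p.length) % 16) (hp : p.length ≤ 7)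
    (hu : hasUnique ((p.support.map f).reverse ++ acc)) :
    DescendsUniquely f p.length x y acc := by
  induction p generalizing acc with
  | nil => exact ⟨rfl, by simpa using hu⟩
  | @cons x w y hadj q ih =>
    simp only [Walk.length_cons] at hl hp ⊢
    have hx := level_lt x
    have hw := level_lt w
    have hy := level_lt y
    rcases level_of_adj hadj with h1 | h1
    · exact ⟨w, ⟨hadj, h1⟩, ih (by omega) (by omega) (by simpa using hu)⟩
    · have := le_length_of_level q (m := q.length + 2) (by omega) (by omega)
      omega

theorem hasUnique_of_conflictFree {V : Type} {G : SimpleGraph V} {f : V → Fin 3} {x y : V}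
    {p : G.Walk x y} (hp : p.IsPath) (h : ConflictFree f p) :
    hasUnique (p.support.map f).reverse := by
  obtain ⟨c, z, ⟨hz, hc⟩, huniq⟩ := h
  have key : (p.support.map f).count c = 1 := by
    classical
    rw [List.count, List.countP_map, List.countP_eq_length_filter]
    have : p.support.filter ((fun b => b == c) ∘ f) = [z] := by
      have hnd := hp.support_nodup.filter ((fun b => b == c) ∘ f)
      apply List.perm_singleton.mp
      rw [List.perm_ext_iff_of_nodup hnd (List.nodup_singleton z)]
      intro w
      simp only [List.mem_filter, Function.comp, beq_iff_eq, List.mem_singleton]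
      exact ⟨fun hw => huniq w hw, fun hw => hw ▸ ⟨hz, hc⟩⟩
    rw [this]; rfl
  unfold hasUnique
  simp only [List.count_reverse]
  fin_cases c <;> simp_all

theorem descendsUniquely_of_isStrongCfvc {f : GV U {C : Finset U // C ∈ 𝒞} → Fin 3}
    (hf : IsStrongCfvc (gadgetGraph 𝒞) f) {n : ℕ} {x y : GV U {C : Finset U // C ∈ 𝒞}}
    (h : Descends 𝒞 n x y) (hn : 0 < n) (hn' : n ≤ 7) : DescendsUniquely f n x y [] := by
  have hl := h.level_eq
  have hy := level_lt y
  have hne : x ≠ y := by rintro rfl; omega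
  obtain ⟨p, hp, hd, hc⟩ := hf x y hne
  obtain ⟨q, hq⟩ := h.exists_walk
  have hle : p.length ≤ n := by rw [hd, ← hq]; exact dist_le q
  have hge := le_length_of_level p hl (by omega)
  obtain rfl : p.length = n := le_antisymm hle hge
  exact descendsUniquely_of_walk p hl hn' (by simpa using hasUnique_of_conflictFree hp hc)

/-- The vertices of level `k` on the part of the gadget between `h_1` and the clause `c`. -/
def ladder (c : {C : Finset U // C ∈ 𝒞}) (k : ℕ) : List (GV U {C : Finset U // C ∈ 𝒞}) :=
  if h : k / 2 < 7 then
    if k % 2 = 0 then [.H ⟨k / 2, h⟩] else [.A ⟨k / 2, h⟩, .B ⟨k / 2, h⟩]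
  else [.cls c]

theorem down_ladder_iff {c : {C : Finset U // C ∈ 𝒞}} {k : ℕ} (hk : k < 14)
    {x w : GV U {C : Finset U // C ∈ 𝒞}} (hx : x ∈ ladder c (k + 1)) :
    Down 𝒞 x w ↔ w ∈ ladder c k := by
  obtain ⟨i, rfl | rfl⟩ := Nat.even_or_odd' k
  · have h1 : (2 * i + 1) / 2 = i := by omega
    have h2 : (2 * i) / 2 = i := by omega
    have h3 : i < 7 := by omega
    simp [ladder, h1, h2, h3] at hx ⊢
    rcases hx with rfl | rfl
    · exact down_A
    · exact down_B
  · have h1 : (2 * i + 1) / 2 = i := by omega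
    have h2 : (2 * i + 1 + 1) / 2 = i + 1 := by omega
    have h3 : i < 7 := by omega
    have h4 : (2 * i + 1 + 1) % 2 = 0 := by omega
    have h5 : (2 * i + 1) % 2 = 1 := by omega
    simp only [ladder, h1, h2, h3, h4, h5] at hx ⊢
    by_cases h6 : i + 1 < 7
    · simp [h6] at hx ⊢
      subst hx
      exact down_H_succ h6
    · simp [h6] at hx ⊢
      obtain rfl : i = 6 := by omega
      subst hx
      exact down_cls

theorem ladder_ne_nil (c : {C : Finset U // C ∈ 𝒞}) (k : ℕ) : ladder c k ≠ [] := by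
  unfold ladder; split_ifs <;> simp

theorem descends_ladder {c : {C : Finset U // C ∈ 𝒞}} {i n : ℕ} (h : i + n < 14)
    {x y : GV U {C : Finset U // C ∈ 𝒞}} (hx : x ∈ ladder c (i + n + 1)) (hy : y ∈ ladder c i) :
    Descends 𝒞 (n + 1) x y := by
  induction n generalizing x with
  | zero => exact ⟨y, (down_ladder_iff h hx).2 hy, rfl⟩
  | succ n ih =>
    obtain ⟨w, hw⟩ := List.exists_mem_of_ne_nil _ (ladder_ne_nil c (i + n + 1))
    exact ⟨w, (down_ladder_iff h hx).2 hw, ih (by omega) hw⟩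

/-- The color lists of the `m` ladder levels `k, k - 1, …`. -/
def ladderColors (f : GV U {C : Finset U // C ∈ 𝒞} → Fin 3) (c : {C : Finset U // C ∈ 𝒞})
    (k m : ℕ) : List (List (Fin 3)) :=
  match m with
  | 0 => []
  | m + 1 => (ladder c k).map f :: ladderColors f c (k - 1) m

theorem length_ladderColors (f : GV U {C : Finset U // C ∈ 𝒞} → Fin 3)
    (c : {C : Finset U // C ∈ 𝒞}) (k m : ℕ) : (ladderColors f c k m).length = m := by
  induction m generalizing k with
  | zero => rfl
  | succ m ih => simp [ladderColors, ih]

theorem take_ladderColors (f : GV U {C : Finset U // C ∈ 𝒞} → Fin 3)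
    (c : {C : Finset U // C ∈ 𝒞}) {k m l : ℕ} (h : l ≤ m) :
    (ladderColors f c k m).take l = ladderColors f c k l := by
  induction m generalizing k l with
  | zero => obtain rfl : l = 0 := by omega
            rfl
  | succ m ih =>
    cases l with
    | zero => rfl
    | succ l => simp [ladderColors, ih (show l ≤ m by omega)]

theorem getLastD_ladderColors (f : GV U {C : Finset U // C ∈ 𝒞} → Fin 3)
    (c : {C : Finset U // C ∈ 𝒞}) (i m : ℕ) (d : List (Fin 3)) :
    (ladderColors f c (i + m) (m + 1)).getLastD d = (ladder c i).map f := by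
  induction m generalizing d with
  | zero => rfl
  | succ m ih =>
    rw [ladderColors, List.getLastD_cons]
    exact ih _

theorem canPick_of_descendsUniquely {f : GV U {C : Finset U // C ∈ 𝒞} → Fin 3}
    {c : {C : Finset U // C ∈ 𝒞}} {i n : ℕ} (h : i + n < 14)
    {x y : GV U {C : Finset U // C ∈ 𝒞}} (hx : x ∈ ladder c (i + n + 1)) {acc : List (Fin 3)}
    (hd : DescendsUniquely f (n + 1) x y acc) :
    canPick (f y) (ladderColors f c (i + n) (n + 1)) (f x :: acc) := by
  induction n generalizing x acc with
  | zero =>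
    obtain ⟨w, -, rfl, hu⟩ := hd
    exact hu
  | succ n ih =>
    obtain ⟨w, hw, hd⟩ := hd
    have hw' := (down_ladder_iff h hx).1 hw
    have := ih (by omega) hw' hd
    simp only [ladderColors, canPick, List.any_eq_true]
    exact ⟨f w, List.mem_map_of_mem hw', this⟩

theorem levelsGood_ladderColors {f : GV U {C : Finset U // C ∈ 𝒞} → Fin 3}
    (hf : IsStrongCfvc (gadgetGraph 𝒞) f) (c : {C : Finset U // C ∈ 𝒞}) {i n : ℕ}
    (h : i + n < 14) (hn : n < 7) : levelsGood (ladderColors f c (i + n + 1) (n + 2)) := by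
  rw [ladderColors, levelsGood]
  simp only [Nat.add_sub_cancel, List.all_eq_true, getLastD_ladderColors, List.forall_mem_map]
  intro x hx y hy
  exact canPick_of_descendsUniquely h hx
    (descendsUniquely_of_isStrongCfvc hf (descends_ladder h hx hy) (by omega) (by omega))

theorem segmentsGood_ladderColors {f : GV U {C : Finset U // C ∈ 𝒞} → Fin 3}
    (hf : IsStrongCfvc (gadgetGraph 𝒞) f) (c : {C : Finset U // C ∈ 𝒞}) {k m : ℕ}
    (hk : k ≤ 14) (hm : m ≤ k + 1) : segmentsGood (ladderColors f c k m) := by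
  simp only [segmentsGood, List.all_eq_true, List.mem_range, length_ladderColors,
    Bool.or_eq_true, decide_eq_true_eq]
  intro n hn
  by_cases h : m < n + 2
  · exact .inl h
  · right
    rw [take_ladderColors f c (by omega)]
    obtain ⟨i, rfl⟩ : ∃ i, k = i + n + 1 := ⟨k - n - 1, by omega⟩
    exact levelsGood_ladderColors hf c (by omega) hn

theorem ne_of_down {f : GV U {C : Finset U // C ∈ 𝒞} → Fin 3}
    (hf : IsStrongCfvc (gadgetGraph 𝒞) f) {x w : GV U {C : Finset U // C ∈ 𝒞}}
    (h : Down 𝒞 x w) : f x ≠ f w := by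
  obtain ⟨z, -, rfl, hu⟩ := descendsUniquely_of_isStrongCfvc hf (n := 1) ⟨w, h, rfl⟩
    (by omega) (by omega)
  revert hu
  generalize f x = s
  generalize f z = t
  revert s t
  decide

theorem ladder_structure {f : GV U {C : Finset U // C ∈ 𝒞} → Fin 3}
    (hf : IsStrongCfvc (gadgetGraph 𝒞) f) (c : {C : Finset U // C ∈ 𝒞}) :
    f (.H 5) = f (.H 1) ∧ f (.H 6) = f (.H 1) ∧ f (.A 1) ≠ f (.B 1) ∧ f (.A 5) ≠ f (.B 5) ∧
    (f (.H 0) = f (.H 1) ∧ f (.A 0) ≠ f (.B 0) ∧ f (.A 0) ≠ f (.H 0) ∧ f (.B 0) ≠ f (.H 0) ∨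
      f (.H 0) ≠ f (.H 1) ∧ f (.A 0) = f (.B 0) ∧ f (.A 0) ≠ f (.H 0) ∧ f (.A 0) ≠ f (.H 1)) ∧
    (f (.cls c) = f (.H 6) ∧ f (.A 6) ≠ f (.B 6) ∨
      f (.cls c) ≠ f (.H 6) ∧ f (.A 6) = f (.B 6) ∧ f (.A 6) ≠ f (.H 6) ∧
        f (.A 6) ≠ f (.cls c)) := by
  have s {k m : ℕ} (hk : k ≤ 14 := by omega) (hm : m ≤ k + 1 := by omega) :
    segmentsGood (ladderColors f c k m) := segmentsGood_ladderColors hf c hk hm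
  obtain ⟨h12, h23, hS1, -⟩ := four_blocks (f (.H 0)) (f (.A 0)) (f (.B 0)) (s (k := 1) (m := 2))
    (f (.H 1)) (s (k := 2) (m := 3)) (f (.A 1)) (f (.B 1)) (s (k := 3) (m := 4))
    (f (.H 2)) (s (k := 4) (m := 5)) (f (.A 2)) (f (.B 2)) (s (k := 5) (m := 6))
    (f (.H 3)) (s (k := 6) (m := 7)) (f (.A 3)) (f (.B 3)) (s (k := 7) (m := 8))
    (f (.H 4)) (s (k := 8) (m := 9))
  obtain ⟨h34, h45, -⟩ := four_blocks (f (.H 2)) (f (.A 2)) (f (.B 2)) (s (k := 5) (m := 2))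
    (f (.H 3)) (s (k := 6) (m := 3)) (f (.A 3)) (f (.B 3)) (s (k := 7) (m := 4))
    (f (.H 4)) (s (k := 8) (m := 5)) (f (.A 4)) (f (.B 4)) (s (k := 9) (m := 6))
    (f (.H 5)) (s (k := 10) (m := 7)) (f (.A 5)) (f (.B 5)) (s (k := 11) (m := 8))
    (f (.H 6)) (s (k := 12) (m := 9))
  obtain ⟨-, h56, -, hS5⟩ := four_blocks (f (.H 3)) (f (.A 3)) (f (.B 3)) (s (k := 7) (m := 2))
    (f (.H 4)) (s (k := 8) (m := 3)) (f (.A 4)) (f (.B 4)) (s (k := 9) (m := 4))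
    (f (.H 5)) (s (k := 10) (m := 5)) (f (.A 5)) (f (.B 5)) (s (k := 11) (m := 6))
    (f (.H 6)) (s (k := 12) (m := 7)) (f (.A 6)) (f (.B 6)) (s (k := 13) (m := 8))
    (f (.cls c)) (s (k := 14) (m := 9))
  have h15 : f (.H 5) = f (.H 1) := by rw [h12, h23, h34, h45]
  refine ⟨h15, h56 ▸ h15, hS1, hS5, ?_, ?_⟩
  · exact first_block (f (.H 0)) (f (.A 0)) (f (.B 0)) (s (k := 1) (m := 2))
      (f (.H 1)) (s (k := 2) (m := 3)) (f (.A 1)) (f (.B 1)) (s (k := 3) (m := 4))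
      (f (.H 2)) (s (k := 4) (m := 5)) h12 hS1
  · exact last_block (f (.H 5)) (f (.A 5)) (f (.B 5)) (f (.H 6)) (s (k := 12) (m := 3))
      (f (.A 6)) (f (.B 6)) (s (k := 13) (m := 4)) (f (.cls c)) (s (k := 14) (m := 5)) h56 hS5

theorem down_H_one {w : GV U {C : Finset U // C ∈ 𝒞}} :
    Down 𝒞 (.H 1) w ↔ w = .A 0 ∨ w = .B 0 := down_H_succ (i := 0) (by omega)

theorem down_H_six {w : GV U {C : Finset U // C ∈ 𝒞}} :
    Down 𝒞 (.H 6) w ↔ w = .A 5 ∨ w = .B 5 := down_H_succ (i := 5) (by omega)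

theorem eq_H_of_down {i : Fin 7} {s w : GV U {C : Finset U // C ∈ 𝒞}} (hs : s = .A i ∨ s = .B i)
    (h : Down 𝒞 s w) : w = .H i := by
  rcases hs with rfl | rfl
  exacts [down_A.1 h, down_B.1 h]

theorem exists_hasUnique_first_to_clause {f : GV U {C : Finset U // C ∈ 𝒞} → Fin 3}
    (hf : IsStrongCfvc (gadgetGraph 𝒞) f) {c : {C : Finset U // C ∈ 𝒞}} (hc : c.1.Nonempty)
    {x : GV U {C : Finset U // C ∈ 𝒞}} (hx : ∀ w, Down 𝒞 x w ↔ w = .H 0) :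
    ∃ v ∈ c.1, hasUnique [f (.cls c), f (.var v), f (.H 0), f x] := by
  obtain ⟨v, hv⟩ := hc
  obtain ⟨_, h1, _, h2, _, h3, rfl, hu⟩ := descendsUniquely_of_isStrongCfvc hf (n := 3)
    (x := x) (y := .cls c) ⟨_, (hx _).2 rfl, _, down_H_zero.2 ⟨v, rfl⟩, _,
      down_var.2 ⟨c, hv, rfl⟩, rfl⟩ (by omega) (by omega)
  obtain rfl := (hx _).1 h1
  obtain ⟨v', rfl⟩ := down_H_zero.1 h2
  obtain ⟨c', hv', h⟩ := down_var.1 h3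
  cases h
  exact ⟨v', hv', hu⟩

theorem exists_hasUnique_second_to_clause {f : GV U {C : Finset U // C ∈ 𝒞} → Fin 3}
    (hf : IsStrongCfvc (gadgetGraph 𝒞) f) {c : {C : Finset U // C ∈ 𝒞}} (hc : c.1.Nonempty)
    (hS : f (.A 0) = f (.B 0))
    {x : GV U {C : Finset U // C ∈ 𝒞}} (hx : ∀ w, Down 𝒞 x w ↔ w = .H 1) :
    ∃ v ∈ c.1, hasUnique [f (.cls c), f (.var v), f (.H 0), f (.A 0), f (.H 1), f x] := by
  obtain ⟨v, hv⟩ := hc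
  obtain ⟨_, h1, s, h2, _, h3, _, h4, _, h5, rfl, hu⟩ := descendsUniquely_of_isStrongCfvc hf
    (n := 5) (x := x) (y := .cls c) ⟨_, (hx _).2 rfl, _, down_H_one.2 (.inl rfl), _,
      down_A.2 rfl, _, down_H_zero.2 ⟨v, rfl⟩, _,
      down_var.2 ⟨c, hv, rfl⟩, rfl⟩ (by omega) (by omega)
  obtain rfl := (hx _).1 h1
  have hs : f s = f (.A 0) := by
    rcases down_H_one.1 h2 with rfl | rfl
    exacts [rfl, hS.symm]
  obtain rfl := eq_H_of_down (down_H_one.1 h2) h3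
  obtain ⟨v', rfl⟩ := down_H_zero.1 h4
  obtain ⟨c', hv', h⟩ := down_var.1 h5
  cases h
  rw [hs] at hu
  exact ⟨v', hv', hu⟩

theorem exists_hasUnique_start_to_sixth {f : GV U {C : Finset U // C ∈ 𝒞} → Fin 3}
    (hf : IsStrongCfvc (gadgetGraph 𝒞) f) {c : {C : Finset U // C ∈ 𝒞}} (hc : c.1.Nonempty)
    (hS : f (.A 6) = f (.B 6))
    {y : GV U {C : Finset U // C ∈ 𝒞}} (hy : y = .A 5 ∨ y = .B 5) :
    ∃ (c' : {C : Finset U // C ∈ 𝒞}) (v : U), v ∈ c'.1 ∧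
      hasUnique [f y, f (.H 6), f (.A 6), f (.cls c'), f (.var v), f (.H 0)] := by
  obtain ⟨v, hv⟩ := hc
  obtain ⟨_, h1, _, h2, s, h3, _, h4, _, h5, rfl, hu⟩ := descendsUniquely_of_isStrongCfvc hf
    (n := 5) (x := .H 0) (y := y) ⟨_, down_H_zero.2 ⟨v, rfl⟩, _,
      down_var.2 ⟨c, hv, rfl⟩, _, down_cls.2 (.inl rfl), _, down_A.2 rfl, _,
      down_H_six.2 hy, rfl⟩ (by omega) (by omega)
  obtain ⟨v', rfl⟩ := down_H_zero.1 h1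
  obtain ⟨c', hv', rfl⟩ := down_var.1 h2
  have hs : f s = f (.A 6) := by
    rcases down_cls.1 h3 with rfl | rfl
    exacts [rfl, hS.symm]
  obtain rfl := eq_H_of_down (down_cls.1 h3) h4
  rw [hs] at hu
  exact ⟨c', v', hv', hu⟩

theorem exists_hasUnique_first_to_sixth {f : GV U {C : Finset U // C ∈ 𝒞} → Fin 3}
    (hf : IsStrongCfvc (gadgetGraph 𝒞) f) {c : {C : Finset U // C ∈ 𝒞}} (hc : c.1.Nonempty)
    (hS : f (.A 6) = f (.B 6)) :
    ∃ (c' : {C : Finset U // C ∈ 𝒞}) (v : U) (s : Fin 3), v ∈ c'.1 ∧ s ≠ f (.H 5) ∧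
      hasUnique [f (.H 5), s, f (.H 6), f (.A 6), f (.cls c'), f (.var v), f (.H 0),
        f (.A 0)] := by
  obtain ⟨v, hv⟩ := hc
  obtain ⟨_, h0, _, h1, _, h2, s, h3, _, h4, t, h5, _, h6, rfl, hu⟩ :=
    descendsUniquely_of_isStrongCfvc hf
    (n := 7) (x := .A 0) (y := .H 5) ⟨_, down_A.2 rfl, _, down_H_zero.2 ⟨v, rfl⟩, _,
      down_var.2 ⟨c, hv, rfl⟩, _, down_cls.2 (.inl rfl), _, down_A.2 rfl, _,
      down_H_six.2 (.inl rfl), _, down_A.2 rfl, rfl⟩ (by omega) (by omega)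
  obtain rfl := down_A.1 h0
  obtain ⟨v', rfl⟩ := down_H_zero.1 h1
  obtain ⟨c', hv', rfl⟩ := down_var.1 h2
  have hs : f s = f (.A 6) := by
    rcases down_cls.1 h3 with rfl | rfl
    exacts [rfl, hS.symm]
  obtain rfl := eq_H_of_down (down_cls.1 h3) h4
  rw [hs] at hu
  exact ⟨c', v', f t, hv', ne_of_down hf h6, hu⟩

set_option synthInstance.maxHeartbeats 400000 in
set_option synthInstance.maxSize 2000 in
theorem first_eq_second {f : GV U {C : Finset U // C ∈ 𝒞} → Fin 3}
    (hf : IsStrongCfvc (gadgetGraph 𝒞) f) {c : {C : Finset U // C ∈ 𝒞}} (hc : c.1.Nonempty) :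
    f (.H 0) = f (.H 1) := by
  obtain ⟨h5, h6, hS1, -, hfirst, hlast⟩ := ladder_structure hf c
  rcases hfirst with h | ⟨hne, hS0, hx0, hx1⟩
  · exact h.1
  exfalso
  by_cases hcH : f (.cls c) = f (.H 0)
  · rcases hlast with h | ⟨hc6, hS6, hx6, hxc⟩
    · exact hne (by rw [← hcH, h.1, h6])
    obtain ⟨c', v, s, hv, hs, hu⟩ := exists_hasUnique_first_to_sixth hf hc hS6
    have hvH := ne_of_down hf (down_H_zero.2 ⟨v, rfl⟩ : Down 𝒞 _ _)
    have hc' : f (.cls c') = f (.H 0) := by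
      obtain ⟨-, -, -, -, -, hlast'⟩ := ladder_structure hf c'
      grind
    have h60 : f (.A 6) = f (.A 0) := by grind
    rw [h5, h6, hc', h60] at hu
    rw [h5] at hs
    clear * - hne hx0 hx1 hs hvH hu
    generalize f (.H 0) = p, f (.H 1) = q, f (.A 0) = r, f (.var v) = t at *
    revert p q r t s
    decide
  · have hA := ne_of_down hf (down_A.2 rfl : Down 𝒞 (.A 1) _)
    have hB := ne_of_down hf (down_B.2 rfl : Down 𝒞 (.B 1) _)
    obtain ⟨x, hx, hfx⟩ : ∃ x, (∀ w, Down 𝒞 x w ↔ w = .H 1) ∧ f x = f (.H 0) := by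
      by_cases h : f (.A 1) = f (.H 0)
      · exact ⟨.A 1, fun w => down_A, h⟩
      · exact ⟨.B 1, fun w => down_B, by grind⟩
    obtain ⟨v, hv, hu⟩ := exists_hasUnique_second_to_clause hf hc hS0 hx
    have hvH := ne_of_down hf (down_H_zero.2 ⟨v, rfl⟩ : Down 𝒞 _ _)
    have hvc := ne_of_down hf (down_var.2 ⟨c, hv, rfl⟩ : Down 𝒞 _ _)
    rw [hfx] at hu
    clear * - hne hx0 hx1 hcH hvH hvc hu
    generalize f (.H 0) = p, f (.H 1) = q, f (.A 0) = r, f (.var v) = t, f (.cls c) = s at *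
    revert p q r t s
    decide

set_option synthInstance.maxHeartbeats 400000 in
set_option synthInstance.maxSize 2000 in
theorem clause_eq_first {f : GV U {C : Finset U // C ∈ 𝒞} → Fin 3}
    (hf : IsStrongCfvc (gadgetGraph 𝒞) f) {c : {C : Finset U // C ∈ 𝒞}} (hc : c.1.Nonempty) :
    f (.cls c) = f (.H 0) := by
  obtain ⟨h5, h6, -, hS5, -, hlast⟩ := ladder_structure hf c
  have h01 := first_eq_second hf hc
  rcases hlast with h | ⟨hc6, hS6, hx6, hxc⟩
  · rw [h.1, h6, h01]
  exfalso
  have hA := ne_of_down hf (down_A.2 rfl : Down 𝒞 (.A 5) _)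
  have hB := ne_of_down hf (down_B.2 rfl : Down 𝒞 (.B 5) _)
  obtain ⟨y, hy, hfy⟩ : ∃ y, (y = .A 5 ∨ y = .B 5) ∧ f y = f (.cls c) := by
    by_cases h : f (.A 5) = f (.cls c)
    · exact ⟨.A 5, .inl rfl, h⟩
    · exact ⟨.B 5, .inr rfl, by grind⟩
  obtain ⟨c', v, hv, hu⟩ := exists_hasUnique_start_to_sixth hf hc hS6 hy
  have hvH := ne_of_down hf (down_H_zero.2 ⟨v, rfl⟩ : Down 𝒞 _ _)
  have hvc := ne_of_down hf (down_var.2 ⟨c', hv, rfl⟩ : Down 𝒞 _ _)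
  have hc' : f (.cls c') = f (.cls c) := by
    obtain ⟨-, -, -, -, -, hlast'⟩ := ladder_structure hf c'
    grind
  rw [hfy, hc', h6, ← h01] at hu
  rw [h6, ← h01] at hc6 hx6
  rw [hc'] at hvc
  clear * - hc6 hx6 hxc hvH hvc hu
  generalize f (.H 0) = p, f (.A 6) = r, f (.var v) = t, f (.cls c) = s at *
  revert p r t s
  decide

theorem exists_nae_of_isStrongCfvc {f : GV U {C : Finset U // C ∈ 𝒞} → Fin 3}
    (hf : IsStrongCfvc (gadgetGraph 𝒞) f) (h𝒞 : ∀ C ∈ 𝒞, C.Nonempty) :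
    ∃ b : U → Bool, ∀ C ∈ 𝒞, (∃ x ∈ C, b x = true) ∧ (∃ y ∈ C, b y = false) := by
  refine ⟨fun v => decide (f (.var v) = f (.A 0)), fun C hC => ?_⟩
  let c : {C : Finset U // C ∈ 𝒞} := ⟨C, hC⟩
  have hc : c.1.Nonempty := h𝒞 C hC
  obtain ⟨-, -, -, -, hfirst, -⟩ := ladder_structure hf c
  have h01 := first_eq_second hf hc
  obtain ⟨hS0, hA0, hB0⟩ := (hfirst.resolve_right fun h => h.1 h01).2
  have hcH := clause_eq_first hf hc
  simp only [decide_eq_true_eq, decide_eq_false_iff_not]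
  constructor
  · obtain ⟨v, hv, hu⟩ := exists_hasUnique_first_to_clause hf hc (x := .B 0) fun _ => down_B
    refine ⟨v, hv, ?_⟩
    have hvH := ne_of_down hf (down_H_zero.2 ⟨v, rfl⟩ : Down 𝒞 _ _)
    rw [hcH] at hu
    clear * - hS0 hA0 hB0 hvH hu
    generalize f (.H 0) = p, f (.A 0) = r, f (.var v) = t, f (.B 0) = s at *
    revert p r t s
    decide
  · obtain ⟨v, hv, hu⟩ := exists_hasUnique_first_to_clause hf hc (x := .A 0) fun _ => down_A
    refine ⟨v, hv, ?_⟩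
    rw [hcH] at hu
    clear * - hA0 hu
    generalize f (.H 0) = p, f (.A 0) = r, f (.var v) = t at *
    revert p r t
    decide

/-- The coloring induced by a truth assignment: the vertices on even levels get color `2`. -/
def coloring {C : Type} (b : U → Bool) : GV U C → Fin 3
  | .var v => if b v then 1 else 0
  | .cls _ => 2
  | .A _ => 0
  | .B _ => 1
  | .H _ => 2

theorem coloring_parity (b : U → Bool) {x y : GV U {C : Finset U // C ∈ 𝒞}}
    (h : (gadgetGraph 𝒞).Adj x y) : coloring b x = 2 ↔ coloring b y ≠ 2 := by
  rw [adj_iff] at h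
  cases x <;> cases y <;> simp [gadgetRel, coloring] at h ⊢ <;> split_ifs <;> decide

theorem adj_A_iff_adj_B {i : Fin 7} {x : GV U {C : Finset U // C ∈ 𝒞}} :
    (gadgetGraph 𝒞).Adj x (.A i) ↔ (gadgetGraph 𝒞).Adj x (.B i) := by
  rw [adj_iff, adj_iff]
  cases x <;> simp [gadgetRel]

theorem exists_recolored_between {b : U → Bool}
    (hb : ∀ C ∈ 𝒞, (∃ x ∈ C, b x = true) ∧ (∃ y ∈ C, b y = false))
    {x z y : GV U {C : Finset U // C ∈ 𝒞}} (hxz : (gadgetGraph 𝒞).Adj x z)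
    (hzy : (gadgetGraph 𝒞).Adj z y) (hxy : x ≠ y) (hz : coloring b z ≠ 2) {e : Fin 3}
    (he : e ≠ 2) :
    ∃ z', (gadgetGraph 𝒞).Adj x z' ∧ (gadgetGraph 𝒞).Adj z' y ∧ coloring b z' = e := by
  have htwin (i : Fin 7) (hx : (gadgetGraph 𝒞).Adj x (.A i))
      (hy : (gadgetGraph 𝒞).Adj y (.A i)) :
      ∃ z', (gadgetGraph 𝒞).Adj x z' ∧ (gadgetGraph 𝒞).Adj z' y ∧ coloring b z' = e := by
    obtain rfl | rfl : e = 0 ∨ e = 1 := by omega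
    · exact ⟨.A i, hx, hy.symm, rfl⟩
    · exact ⟨.B i, adj_A_iff_adj_B.1 hx, (adj_A_iff_adj_B.1 hy).symm, rfl⟩
  have hclause (c : {C : Finset U // C ∈ 𝒞}) : ∃ v ∈ c.1, coloring b (.var v : GV U
      {C : Finset U // C ∈ 𝒞}) = e := by
    obtain ⟨⟨v, hv, hbv⟩, ⟨w, hw, hbw⟩⟩ := hb c.1 c.2
    obtain rfl | rfl : e = 0 ∨ e = 1 := by omega
    · exact ⟨w, hw, by simp [coloring, hbw]⟩
    · exact ⟨v, hv, by simp [coloring, hbv]⟩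
  cases z with
  | cls c => exact absurd rfl hz
  | H i => exact absurd rfl hz
  | A i => exact htwin i hxz hzy.symm
  | B i => exact htwin i (adj_A_iff_adj_B.2 hxz) (adj_A_iff_adj_B.2 hzy.symm)
  | var v =>
    rw [adj_iff] at hxz hzy
    cases x with
    | var => simp [gadgetRel] at hxz
    | A => simp [gadgetRel] at hxz
    | B => simp [gadgetRel] at hxz
    | cls c =>
      cases y with
      | var => simp [gadgetRel] at hzy
      | A => simp [gadgetRel] at hzy
      | B => simp [gadgetRel] at hzy
      | cls d => exact htwin 6 (adj_iff.2 (.inr rfl)) (adj_iff.2 (.inr rfl))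
      | H i =>
        obtain ⟨v', hv', he'⟩ := hclause c
        exact ⟨.var v', adj_iff.2 (.inl hv'), adj_iff.2 (by simpa [gadgetRel] using hzy), he'⟩
    | H i =>
      cases y with
      | var => simp [gadgetRel] at hzy
      | A => simp [gadgetRel] at hzy
      | B => simp [gadgetRel] at hzy
      | cls d =>
        obtain ⟨v', hv', he'⟩ := hclause d
        exact ⟨.var v', adj_iff.2 (by simpa [gadgetRel] using hxz), adj_iff.2 (.inr hv'), he'⟩
      | H j =>
        simp only [gadgetRel, or_false, false_or] at hxz hzy
        exact absurd (congrArg GV.H (Fin.ext (hxz.trans hzy.symm))) hxy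

theorem exists_recolored_walk {b : U → Bool}
    (hb : ∀ C ∈ 𝒞, (∃ x ∈ C, b x = true) ∧ (∃ y ∈ C, b y = false)) {e : Fin 3} (he : e ≠ 2)
    {x y : GV U {C : Finset U // C ∈ 𝒞}} (p : (gadgetGraph 𝒞).Walk x y) (hp : p.IsPath)
    (hx : coloring b x = 2) :
    ∃ q : (gadgetGraph 𝒞).Walk x y, q.length = p.length ∧
      ∀ z ∈ q.support, coloring b z = 2 ∨ coloring b z = e ∨ z = y := by
  match p, hp with
  | .nil, _ => exact ⟨.nil, rfl, by simp⟩
  | .cons h .nil, _ => exact ⟨.cons h .nil, rfl, by simp [hx]⟩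
  | .cons (v := z) h (.cons (v := w) h' r), hp =>
    have hz := (coloring_parity b h).1 hx
    have hw : coloring b w = 2 := by
      by_contra hw
      exact hz ((coloring_parity b h').2 hw)
    have hxw : x ≠ w := by
      rintro rfl
      simp [Walk.cons_isPath_iff] at hp
    obtain ⟨z', hxz', hz'w, hz'⟩ := exists_recolored_between hb h h' hxw hz he
    obtain ⟨q, hq, hqs⟩ := exists_recolored_walk hb he r hp.of_cons.of_cons hw
    refine ⟨.cons hxz' (.cons hz'w q), by simp [hq], ?_⟩
    simp only [Walk.support_cons, List.mem_cons]
    rintro u (rfl | rfl | hu)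
    exacts [.inl hx, .inr (.inl hz'), hqs u hu]
termination_by p.length

theorem exists_conflictFree_of_even {b : U → Bool}
    (hb : ∀ C ∈ 𝒞, (∃ x ∈ C, b x = true) ∧ (∃ y ∈ C, b y = false))
    {x y : GV U {C : Finset U // C ∈ 𝒞}} (p : (gadgetGraph 𝒞).Walk x y) (hp : p.IsPath)
    (hxy : x ≠ y) (hx : coloring b x = 2) :
    ∃ q : (gadgetGraph 𝒞).Walk x y, q.length = p.length ∧ ConflictFree (coloring b) q := by
  match p, hp with
  | .nil, _ => exact absurd rfl hxy
  | .cons h .nil, _ =>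
    have hy := (coloring_parity b h).1 hx
    refine ⟨.cons h .nil, rfl, 2, x, by simp [hx], ?_⟩
    simp only [Walk.support_cons, Walk.support_nil, List.mem_cons, List.not_mem_nil, or_false]
    rintro z ⟨rfl | rfl, hz⟩
    exacts [rfl, absurd hz hy]
  | .cons (v := z) h (.cons (v := w) h' r), hp =>
    have hz := (coloring_parity b h).1 hx
    have hw : coloring b w = 2 := by
      by_contra hw
      exact hz ((coloring_parity b h').2 hw)
    have hxw : x ≠ w := by
      rintro rfl
      simp [Walk.cons_isPath_iff] at hp
    obtain ⟨e, e', he, he', hne, hy⟩ : ∃ e e' : Fin 3, e ≠ 2 ∧ e' ≠ 2 ∧ e ≠ e' ∧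
        (coloring b y = 2 ∨ coloring b y = e) := by
      generalize coloring b y = s
      revert s
      decide
    obtain ⟨z', hxz', hz'w, hz'⟩ := exists_recolored_between hb h h' hxw hz he'
    obtain ⟨q, hq, hqs⟩ := exists_recolored_walk hb he r hp.of_cons.of_cons hw
    refine ⟨.cons hxz' (.cons hz'w q), by simp [hq], e', z', by simp [hz'], ?_⟩
    simp only [Walk.support_cons, List.mem_cons]
    rintro u ⟨rfl | rfl | hu, hue⟩
    · exact absurd (hue.symm.trans hx) he'
    · rfl
    · rcases hqs u hu with h | h | rfl <;> grind

theorem exists_conflictFree_of_odd {b : U → Bool}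
    (hb : ∀ C ∈ 𝒞, (∃ x ∈ C, b x = true) ∧ (∃ y ∈ C, b y = false))
    {x y : GV U {C : Finset U // C ∈ 𝒞}} (p : (gadgetGraph 𝒞).Walk x y) (hp : p.IsPath)
    (hxy : x ≠ y) (hx : coloring b x ≠ 2) (hy : coloring b y ≠ 2) :
    ∃ q : (gadgetGraph 𝒞).Walk x y, q.length = p.length ∧ ConflictFree (coloring b) q := by
  match p, hp with
  | .nil, _ => exact absurd rfl hxy
  | .cons (v := z) h r, hp =>
    have hz : coloring b z = 2 := by
      by_contra hz
      exact hx ((coloring_parity b h).2 hz)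
    by_cases hc : coloring b x = coloring b y
    · match r, hp with
      | .nil, _ => exact absurd hz hy
      | .cons h' .nil, _ =>
        refine ⟨.cons h (.cons h' .nil), rfl, 2, z, by simp [hz], ?_⟩
        simp only [Walk.support_cons, Walk.support_nil, List.mem_cons, List.not_mem_nil, or_false]
        rintro u ⟨rfl | rfl | rfl, hu⟩
        exacts [absurd hu hx, rfl, absurd hu hy]
      | .cons (v := w) h' (.cons (v := t) h'' r'), hp =>
        have hw := (coloring_parity b h').1 hz
        have ht : coloring b t = 2 := by
          by_contra ht
          exact hw ((coloring_parity b h'').2 ht)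
        have hzt : z ≠ t := by
          rintro rfl
          simp [Walk.cons_isPath_iff] at hp
        obtain ⟨e, he, hey⟩ : ∃ e : Fin 3, e ≠ 2 ∧ e ≠ coloring b y := by
          generalize coloring b y = s
          revert s
          decide
        obtain ⟨w', hzw', hw't, hw'⟩ := exists_recolored_between hb h' h'' hzt hw he
        obtain ⟨q, hq, hqs⟩ := exists_recolored_walk hb hy r' hp.of_cons.of_cons.of_cons ht
        refine ⟨.cons h (.cons hzw' (.cons hw't q)), by simp [hq], e, w', by simp [hw'], ?_⟩
        simp only [Walk.support_cons, List.mem_cons]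
        rintro u ⟨rfl | rfl | rfl | hu, hue⟩
        · exact absurd (hue.symm.trans hc) hey
        · exact absurd (hue.symm.trans hz) he
        · rfl
        · rcases hqs u hu with h | h | rfl <;> grind
    · obtain ⟨q, hq, hqs⟩ := exists_recolored_walk hb hy r hp.of_cons hz
      refine ⟨.cons h q, by simp [hq], coloring b x, x, by simp, ?_⟩
      simp only [Walk.support_cons, List.mem_cons]
      rintro u ⟨rfl | hu, hue⟩
      · rfl
      · rcases hqs u hu with h | h | rfl <;> grind

theorem conflictFree_reverse {V : Type} {G : SimpleGraph V} {f : V → Fin 3} {x y : V}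
    {p : G.Walk x y} (h : ConflictFree f p) : ConflictFree f p.reverse := by
  simpa [ConflictFree] using h

theorem exists_conflictFree {b : U → Bool}
    (hb : ∀ C ∈ 𝒞, (∃ x ∈ C, b x = true) ∧ (∃ y ∈ C, b y = false))
    {x y : GV U {C : Finset U // C ∈ 𝒞}} (p : (gadgetGraph 𝒞).Walk x y) (hp : p.IsPath)
    (hxy : x ≠ y) :
    ∃ q : (gadgetGraph 𝒞).Walk x y, q.length = p.length ∧ ConflictFree (coloring b) q := by
  by_cases hx : coloring b x = 2
  · exact exists_conflictFree_of_even hb p hp hxy hx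
  by_cases hy : coloring b y = 2
  · obtain ⟨q, hq, hc⟩ := exists_conflictFree_of_even hb p.reverse hp.reverse hxy.symm hy
    exact ⟨q.reverse, by simpa using hq, conflictFree_reverse hc⟩
  · exact exists_conflictFree_of_odd hb p hp hxy hx hy

theorem reachable_H_zero (h𝒞 : ∀ C ∈ 𝒞, C.Nonempty) (x : GV U {C : Finset U // C ∈ 𝒞}) :
    (gadgetGraph 𝒞).Reachable x (.H 0) := by
  have hH (i : ℕ) (hi : i < 7) : (gadgetGraph 𝒞).Reachable (.H ⟨i, hi⟩) (.H 0) := by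
    induction i with
    | zero => exact .rfl
    | succ i ih =>
      exact ((down_H_succ hi).2 (.inl rfl)).1.reachable.trans
        ((down_A.2 rfl).1.reachable.trans (ih (by omega)))
  have hvar (v : U) : (gadgetGraph 𝒞).Reachable (.var v) (.H 0) :=
    (down_H_zero.2 ⟨v, rfl⟩).1.reachable.symm
  cases x with
  | var v => exact hvar v
  | cls c =>
    obtain ⟨v, hv⟩ := h𝒞 c.1 c.2
    exact (down_var.2 ⟨c, hv, rfl⟩).1.reachable.symm.trans (hvar v)
  | A i => exact (down_A.2 rfl).1.reachable.trans (hH i i.2)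
  | B i => exact (down_B.2 rfl).1.reachable.trans (hH i i.2)
  | H i => exact hH i i.2

theorem isStrongCfvc_coloring {b : U → Bool} (h𝒞 : ∀ C ∈ 𝒞, C.Nonempty)
    (hb : ∀ C ∈ 𝒞, (∃ x ∈ C, b x = true) ∧ (∃ y ∈ C, b y = false)) :
    IsStrongCfvc (gadgetGraph 𝒞) (coloring b) := by
  intro x y hxy
  obtain ⟨p, hp, hd⟩ := ((reachable_H_zero h𝒞 x).trans
    (reachable_H_zero h𝒞 y).symm).exists_path_of_dist
  obtain ⟨q, hq, hc⟩ := exists_conflictFree hb p hp hxy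
  exact ⟨q, q.isPath_of_length_eq_dist (hq.trans hd), hq.trans hd, hc⟩

end Gadget

/-- `(U, 𝒞)` admits an NAE-assignment (an assignment giving each clause
at least one true and at least one false variable) if and only if the gadget graph
`G(U, 𝒞)` is strongly conflict-free vertex-connection 3-colorable. -/
theorem nae_iff_gadget_strongCfvc_three_colorable {U : Type} [Fintype U] [Nonempty U]
    (𝒞 : Finset (Finset U)) (h𝒞 : ∀ C ∈ 𝒞, 2 ≤ C.card) (h𝒞ne : 𝒞.Nonempty) :
    (∃ b : U → Bool, ∀ C ∈ 𝒞, (∃ x ∈ C, b x = true) ∧ (∃ y ∈ C, b y = false)) ↔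
    (∃ f : GV U {C : Finset U // C ∈ 𝒞} → Fin 3, IsStrongCfvc (gadgetGraph 𝒞) f) := by
  have hne : ∀ C ∈ 𝒞, C.Nonempty := fun C hC =>
    Finset.card_pos.1 (zero_lt_two.trans_le (h𝒞 C hC))
  constructor
  · rintro ⟨b, hb⟩
    exact ⟨Gadget.coloring b, Gadget.isStrongCfvc_coloring hne hb⟩
  · rintro ⟨f, hf⟩
    exact Gadget.exists_nae_of_isStrongCfvc hf hne
end
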